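/- arXiv:1511.01175 — 2 statements merged into one kernel-verified Lean document; each statement's English description precedes it below -/
import Mathlib

section
/- Fix a constant γ > 0 and a function d : ℕ → ℕ with d(n) ≥ 1 for all n and d(n)/√n → 0 as n → ∞. For each n with d(n)·n even, let P be a uniformly random pairing with n bins of size d(n). Then the limsup, over such n tending to infinity, of the probability that P ∉ A is at most 1/(1+γ); that is, the probability of initial rejection is at most 1/(1+γ) + o(1). -/
/-!
Formalization of the pairing model of random `d`-regular (multi)graphs and of the
switchings used in the uniform sampler *REG* of Gao and Wormald,
"Uniform generation of random regular graphs".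

Bins are elements of `Fin n`; each bin contains `d` points, so points are
elements of `Fin n × Fin d`.  A pairing is a perfect matching of the points,
modelled as a fixed-point-free involution on the points: the pairs of the
pairing are the orbits `{x, P.f x}`.
-/

namespace Reg

abbrev Point (n d : ℕ) := Fin n × Fin d

/-- A pairing: a perfect matching of the `d * n` points, encoded as a
fixed-point-free involution.  The pairs are the 2-element sets `{x, f x}`. -/
structure Pairing (n d : ℕ) where
  f : Point n d → Point n d
  invol : ∀ x, f (f x) = x
  nofix : ∀ x, f x ≠ x

instance {n d : ℕ} : Finite (Pairing n d) :=
  Finite.of_injective (fun P => P.f) fun P Q h => by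
    cases P; cases Q; congr

variable {n d : ℕ}

/-- The number of pairs of `P` with one point in bin `u` and one point in bin `v`
(for distinct bins `u ≠ v` this is the multiplicity of the edge `uv`). -/
def mult (P : Pairing n d) (u v : Fin n) : ℕ :=
  (Finset.univ.filter fun a : Point n d => a.1 = u ∧ (P.f a).1 = v).card

/-- Two bins are adjacent if some pair of the pairing joins them. -/
def Adj (P : Pairing n d) (u v : Fin n) : Prop := u ≠ v ∧ 1 ≤ mult P u v

/-- The number of loops of `P` (pairs whose two points lie in the same bin). -/
def numLoops (P : Pairing n d) : ℕ :=
  (Finset.univ.filter fun a : Point n d => (P.f a).1 = a.1).card / 2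

/-- The number of loops of `P` lying in bin `u`. -/
def loopsAt (P : Pairing n d) (u : Fin n) : ℕ :=
  (Finset.univ.filter fun a : Point n d => a.1 = u ∧ (P.f a).1 = u).card / 2

/-- The number of (unordered) pairs of distinct bins joined by exactly `k` pairs of `P`,
i.e. the number of edges of multiplicity exactly `k`. -/
def edgesWithMult (P : Pairing n d) (k : ℕ) : ℕ :=
  (Finset.univ.filter fun q : Fin n × Fin n => q.1 < q.2 ∧ mult P q.1 q.2 = k).card

/-- `M1 = dn` as a real number. -/
noncomputable def M1R (n d : ℕ) : ℝ := (d : ℝ) * n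

/-- `M2 = n d (d-1)` as a real number. -/
noncomputable def M2R (n d : ℕ) : ℝ := (n : ℝ) * d * ((d : ℝ) - 1)

/-- `M3 = n d (d-1) (d-2)` as a real number. -/
noncomputable def M3R (n d : ℕ) : ℝ := (n : ℝ) * d * ((d : ℝ) - 1) * ((d : ℝ) - 2)

/-- `i1 = ⌊(1+γ)(d-1)²/4⌋`. -/
noncomputable def i1Nat (d : ℕ) (γ : ℝ) : ℕ := (⌊(1 + γ) * ((d : ℝ) - 1) ^ 2 / 4⌋).toNat

/-- The stratum `S_i` of the double-edge reduction phase: pairings with no loops,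
every edge of multiplicity at most 2, and exactly `i` double edges. -/
def SD (n d i : ℕ) : Set (Pairing n d) :=
  {P | numLoops P = 0 ∧ (∀ u v : Fin n, u ≠ v → mult P u v ≤ 2) ∧ edgesWithMult P 2 = i}

/-- `Φ1 = ⋃_{0 ≤ i ≤ m} S_i`. -/
def Phi1 (n d m : ℕ) : Set (Pairing n d) := {P | ∃ i ≤ m, P ∈ SD n d i}

/-- The labelled data (points 1–8) of a d-switching. -/
structure DSwitch (n d : ℕ) where
  p1 : Point n d
  p2 : Point n d
  p3 : Point n d
  p4 : Point n d
  p5 : Point n d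
  p6 : Point n d
  p7 : Point n d
  p8 : Point n d

/-- The four target bin-pairs `u1u2, u1u3, v1v2, v1v3` of a d-switching. -/
def targets (s : DSwitch n d) : List (Fin n × Fin n) :=
  [(s.p1.1, s.p5.1), (s.p1.1, s.p7.1), (s.p2.1, s.p6.1), (s.p2.1, s.p8.1)]

/-- `s` is a valid d-switching on `P`. -/
def IsDSwitch (P : Pairing n d) (s : DSwitch n d) : Prop :=
  P.f s.p1 = s.p2 ∧ P.f s.p3 = s.p4 ∧ P.f s.p5 = s.p6 ∧ P.f s.p7 = s.p8 ∧
  s.p1.1 = s.p3.1 ∧ s.p2.1 = s.p4.1 ∧ s.p1 ≠ s.p3 ∧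
  mult P s.p1.1 s.p2.1 = 2 ∧ mult P s.p5.1 s.p6.1 = 1 ∧ mult P s.p7.1 s.p8.1 = 1 ∧
  [s.p1.1, s.p2.1, s.p5.1, s.p6.1, s.p7.1, s.p8.1].Pairwise (· ≠ ·)

/-- The number of target bin-pairs of `s` joined by at least one pair of `P`. -/
def joinedCount (P : Pairing n d) (s : DSwitch n d) : ℕ :=
  (targets s).countP fun t => decide (1 ≤ mult P t.1 t.2)

/-- A type I switching: a d-switching creating at most one new double edge. -/
def IsTypeI (P : Pairing n d) (s : DSwitch n d) : Prop :=
  IsDSwitch P s ∧ (∀ t ∈ targets s, mult P t.1 t.2 ≤ 1) ∧ joinedCount P s ≤ 1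

/-- A type I switching of class A: it creates no new double edge. -/
def IsTypeIA (P : Pairing n d) (s : DSwitch n d) : Prop := IsTypeI P s ∧ joinedCount P s = 0

/-- A type I switching of class B: it creates exactly one new double edge. -/
def IsTypeIB (P : Pairing n d) (s : DSwitch n d) : Prop := IsTypeI P s ∧ joinedCount P s = 1

/-- The labelled data (points 1–12) of a type II switching. -/
structure DSwitch2 (n d : ℕ) extends DSwitch n d where
  p9 : Point n d
  p10 : Point n d
  p11 : Point n d
  p12 : Point n d

/-- A type II switching: a d-switching creating exactly two new double edges, both
incident with `u1` or both incident with `v1`, together with the labelling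
`{9,10}, {11,12}` (with 9 and 12 in `u1`, resp. `v1`) of the two existing pairs
joining the two joined target bin-pairs. -/
def IsTypeII (P : Pairing n d) (s : DSwitch2 n d) : Prop :=
  IsDSwitch P s.toDSwitch ∧ (∀ t ∈ targets s.toDSwitch, mult P t.1 t.2 ≤ 1) ∧
  P.f s.p9 = s.p10 ∧ P.f s.p11 = s.p12 ∧
  ((s.p9.1 = s.p1.1 ∧ s.p12.1 = s.p1.1 ∧
      ((s.p10.1 = s.p5.1 ∧ s.p11.1 = s.p7.1) ∨ (s.p10.1 = s.p7.1 ∧ s.p11.1 = s.p5.1)) ∧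
      mult P s.p1.1 s.p5.1 = 1 ∧ mult P s.p1.1 s.p7.1 = 1 ∧
      mult P s.p2.1 s.p6.1 = 0 ∧ mult P s.p2.1 s.p8.1 = 0) ∨
    (s.p9.1 = s.p2.1 ∧ s.p12.1 = s.p2.1 ∧
      ((s.p10.1 = s.p6.1 ∧ s.p11.1 = s.p8.1) ∨ (s.p10.1 = s.p8.1 ∧ s.p11.1 = s.p6.1)) ∧
      mult P s.p2.1 s.p6.1 = 1 ∧ mult P s.p2.1 s.p8.1 = 1 ∧
      mult P s.p1.1 s.p5.1 = 0 ∧ mult P s.p1.1 s.p7.1 = 0))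

/-- Conjugating a pairing by a permutation of the points: the pairs of
`conj P τ` are the images under `τ` of the pairs of `P`. -/
def conj (P : Pairing n d) (τ : Equiv.Perm (Point n d)) : Pairing n d where
  f := fun x => τ (P.f (τ.symm x))
  invol := by intro x; simp [P.invol]
  nofix := by
    intro x h
    refine P.nofix (τ.symm x) ?_
    have h3 := congrArg τ.symm h
    simpa using h3

/-- The permutation performing a d-switching: it replaces the pairs
`{1,2},{3,4},{5,6},{7,8}` by `{1,5},{3,7},{2,6},{4,8}`. -/
def dtau (s : DSwitch n d) : Equiv.Perm (Point n d) :=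
  (Equiv.swap s.p4 s.p7).trans (Equiv.swap s.p2 s.p5)

/-- The pairing resulting from performing a d-switching. -/
def dResult (P : Pairing n d) (s : DSwitch n d) : Pairing n d := conj P (dtau s)

/-- `f_I(P)`: the number of type I switchings on `P`. -/
noncomputable def fI (P : Pairing n d) : ℕ := Nat.card {s : DSwitch n d // IsTypeI P s}

/-- `f_II(P)`: the number of type II switchings on `P`. -/
noncomputable def fII (P : Pairing n d) : ℕ := Nat.card {s : DSwitch2 n d // IsTypeII P s}

/-- `b_A(P)`: the number of class A switchings from pairings in `Φ1` producing `P`. -/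
noncomputable def bA (m : ℕ) (P : Pairing n d) : ℕ :=
  Nat.card {q : Pairing n d × DSwitch n d //
    q.1 ∈ Phi1 n d m ∧ IsTypeIA q.1 q.2 ∧ dResult q.1 q.2 = P}

/-- `b_B(P)`: the number of class B switchings (of type I or type II) from
pairings in `Φ1` producing `P`. -/
noncomputable def bB (m : ℕ) (P : Pairing n d) : ℕ :=
  Nat.card {q : Pairing n d × DSwitch n d //
    q.1 ∈ Phi1 n d m ∧ IsTypeIB q.1 q.2 ∧ dResult q.1 q.2 = P} +
  Nat.card {q : Pairing n d × DSwitch2 n d //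
    q.1 ∈ Phi1 n d m ∧ IsTypeII q.1 q.2 ∧ dResult q.1 q.2.toDSwitch = P}

/-- `B_D = ⌊(1+γ)(d-1)²/4⌋`. -/
noncomputable def BD (d : ℕ) (γ : ℝ) : ℕ := i1Nat d γ

/-- `B_L = max(⌈log dn⌉, 4d)`. -/
noncomputable def BL (n d : ℕ) : ℕ := max (⌈Real.log ((d : ℝ) * n)⌉.toNat) (4 * d)

/-- `B_T = max(⌈log dn⌉, ⌈d³/n⌉)`. -/
noncomputable def BT (n d : ℕ) : ℕ :=
  max (⌈Real.log ((d : ℝ) * n)⌉.toNat) (⌈(d : ℝ) ^ 3 / (n : ℝ)⌉.toNat)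

/-- The set `A` of pairings that are not initially rejected:
`D(P) ≤ B_D`, `L(P) ≤ B_L` and `T(P) ≤ B_T`. -/
def AccSet (n d : ℕ) (γ : ℝ) : Set (Pairing n d) :=
  {P | edgesWithMult P 2 ≤ BD d γ ∧ numLoops P ≤ BL n d ∧ edgesWithMult P 3 ≤ BT n d}

/-- The stratum `S^L_i` of the loop reduction phase. -/
def SL (n d : ℕ) (γ : ℝ) (i : ℕ) : Set (Pairing n d) :=
  {P | numLoops P = i ∧ (∀ u : Fin n, loopsAt P u ≤ 1) ∧
    edgesWithMult P 2 ≤ BD d γ ∧ edgesWithMult P 3 ≤ BT n d ∧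
    ∀ u v : Fin n, u ≠ v → mult P u v ≤ 3}

/-- The labelled data (points 1–6) of a type L switching. -/
structure LSwitch (n d : ℕ) where
  q1 : Point n d
  q2 : Point n d
  q3 : Point n d
  q4 : Point n d
  q5 : Point n d
  q6 : Point n d

/-- `s` is a valid type L switching on `P`. -/
def IsLSwitch (P : Pairing n d) (s : LSwitch n d) : Prop :=
  P.f s.q1 = s.q2 ∧ s.q1.1 = s.q2.1 ∧
  P.f s.q3 = s.q4 ∧ P.f s.q5 = s.q6 ∧
  mult P s.q3.1 s.q4.1 = 1 ∧ mult P s.q5.1 s.q6.1 = 1 ∧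
  [s.q1.1, s.q3.1, s.q4.1, s.q5.1, s.q6.1].Pairwise (· ≠ ·) ∧
  mult P s.q1.1 s.q3.1 = 0 ∧ mult P s.q1.1 s.q5.1 = 0 ∧ mult P s.q4.1 s.q6.1 = 0

/-- The permutation performing a type L switching: it replaces the pairs
`{1,2},{3,4},{5,6}` by `{1,3},{2,5},{4,6}`. -/
def ltau (s : LSwitch n d) : Equiv.Perm (Point n d) :=
  (Equiv.swap s.q4 s.q5).trans (Equiv.swap s.q2 s.q3)

/-- The pairing resulting from performing a type L switching. -/
def lResult (P : Pairing n d) (s : LSwitch n d) : Pairing n d := conj P (ltau s)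

/-- `f_L(P)`: the number of type L switchings on `P`. -/
noncomputable def fL (P : Pairing n d) : ℕ := Nat.card {s : LSwitch n d // IsLSwitch P s}

/-- `b_A^L(P)`: the number of type L switchings from pairings in
`⋃_{0 ≤ j ≤ B_L} S^L_j` producing `P`. -/
noncomputable def bAL (γ : ℝ) (P : Pairing n d) : ℕ :=
  Nat.card {q : Pairing n d × LSwitch n d //
    (∃ j ≤ BL n d, q.1 ∈ SL n d γ j) ∧ IsLSwitch q.1 q.2 ∧ lResult q.1 q.2 = P}

/-- The stratum `S^T_i` of the triple-edge reduction phase. -/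
def ST (n d : ℕ) (γ : ℝ) (i : ℕ) : Set (Pairing n d) :=
  {P | numLoops P = 0 ∧ edgesWithMult P 3 = i ∧ edgesWithMult P 2 ≤ BD d γ ∧
    ∀ u v : Fin n, u ≠ v → mult P u v ≤ 3}

/-- The labelled data (points 1–12) of a type T switching. -/
structure TSwitch (n d : ℕ) where
  r1 : Point n d
  r2 : Point n d
  r3 : Point n d
  r4 : Point n d
  r5 : Point n d
  r6 : Point n d
  r7 : Point n d
  r8 : Point n d
  r9 : Point n d
  r10 : Point n d
  r11 : Point n d
  r12 : Point n d

/-- `s` is a valid type T switching on `P`. -/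
def IsTSwitch (P : Pairing n d) (s : TSwitch n d) : Prop :=
  P.f s.r1 = s.r2 ∧ P.f s.r3 = s.r4 ∧ P.f s.r5 = s.r6 ∧
  P.f s.r7 = s.r8 ∧ P.f s.r9 = s.r10 ∧ P.f s.r11 = s.r12 ∧
  s.r1.1 = s.r3.1 ∧ s.r3.1 = s.r5.1 ∧ s.r2.1 = s.r4.1 ∧ s.r4.1 = s.r6.1 ∧
  s.r1 ≠ s.r3 ∧ s.r3 ≠ s.r5 ∧ s.r1 ≠ s.r5 ∧
  mult P s.r1.1 s.r2.1 = 3 ∧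
  mult P s.r7.1 s.r8.1 = 1 ∧ mult P s.r9.1 s.r10.1 = 1 ∧ mult P s.r11.1 s.r12.1 = 1 ∧
  [s.r1.1, s.r2.1, s.r7.1, s.r8.1, s.r9.1, s.r10.1, s.r11.1, s.r12.1].Pairwise (· ≠ ·) ∧
  mult P s.r1.1 s.r7.1 = 0 ∧ mult P s.r1.1 s.r9.1 = 0 ∧ mult P s.r1.1 s.r11.1 = 0 ∧
  mult P s.r2.1 s.r8.1 = 0 ∧ mult P s.r2.1 s.r10.1 = 0 ∧ mult P s.r2.1 s.r12.1 = 0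

/-- The permutation performing a type T switching: it replaces the pairs
`{1,2},{3,4},{5,6},{7,8},{9,10},{11,12}` by `{1,7},{2,8},{3,9},{4,10},{5,11},{6,12}`. -/
def ttau (s : TSwitch n d) : Equiv.Perm (Point n d) :=
  ((Equiv.swap s.r2 s.r7).trans (Equiv.swap s.r4 s.r9)).trans (Equiv.swap s.r6 s.r11)

/-- The pairing resulting from performing a type T switching. -/
def tResult (P : Pairing n d) (s : TSwitch n d) : Pairing n d := conj P (ttau s)

/-- `f_T(P)`: the number of type T switchings on `P`. -/
noncomputable def fT (P : Pairing n d) : ℕ := Nat.card {s : TSwitch n d // IsTSwitch P s}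

/-- `b_A^T(P)`: the number of type T switchings from pairings in
`⋃_{0 ≤ j ≤ B_T} S^T_j` producing `P`. -/
noncomputable def bAT (γ : ℝ) (P : Pairing n d) : ℕ :=
  Nat.card {q : Pairing n d × TSwitch n d //
    (∃ j ≤ BT n d, q.1 ∈ ST n d γ j) ∧ IsTSwitch q.1 q.2 ∧ tResult q.1 q.2 = P}

/-- The endpoints of the pair of `P` containing the point `a` lie in bins
`w1, w2` such that `u, v, w1, w2` are four distinct bins, `w1` is adjacent to `u`
and `w2` is adjacent to `v`. -/
def GoodPair (u v : Fin n) (P : Pairing n d) (a : Point n d) : Prop :=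
  ∃ w1 w2 : Fin n,
    ((w1 = a.1 ∧ w2 = (P.f a).1) ∨ (w1 = (P.f a).1 ∧ w2 = a.1)) ∧
    [u, v, w1, w2].Pairwise (· ≠ ·) ∧ Adj P w1 u ∧ Adj P w2 v

/-- Four times the number of unordered pairs `{e, e'}` of distinct pairs of `P`
joining the same two distinct bins: ordered pairs of points `(a, b)` lying in a
common bin whose mates also lie in a common (different) bin. -/
def parallelOrdered (P : Pairing n d) : ℕ :=
  (Finset.univ.filter fun q : Point n d × Point n d =>
    q.1.1 = q.2.1 ∧ (P.f q.1).1 = (P.f q.2).1 ∧ q.1.1 ≠ (P.f q.1).1 ∧ q.1 ≠ q.2).card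

/-- Twice the number of unordered pairs of two distinct double edges of `P`
sharing a common bin (double edges being recorded as ordered bin-pairs `(u,v)`
with `u < v`). -/
def doubleSharedOrdered (P : Pairing n d) : ℕ :=
  (Finset.univ.filter fun q : (Fin n × Fin n) × (Fin n × Fin n) =>
    q.1.1 < q.1.2 ∧ q.2.1 < q.2.2 ∧ mult P q.1.1 q.1.2 = 2 ∧ mult P q.2.1 q.2.2 = 2 ∧
    q.1 ≠ q.2 ∧
    (q.1.1 = q.2.1 ∨ q.1.1 = q.2.2 ∨ q.1.2 = q.2.1 ∨ q.1.2 = q.2.2)).card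

/-- `m̄_I(i) = 4 i (M1 - 4i)²`. -/
noncomputable def mbarIp (nR dR : ℝ) (i : ℕ) : ℝ := 4 * i * (dR * nR - 4 * i) ^ 2

/-- `m̄_II(i) = 16 i (d-1)² (d-2) (d-3)`. -/
noncomputable def mbarIIp (dR : ℝ) (i : ℕ) : ℝ :=
  16 * i * (dR - 1) ^ 2 * (dR - 2) * (dR - 3)

/-- `m̲_A(i) = M2² - M2 (d-1) (16 i + 3d² + d + 6)`. -/
noncomputable def mAp (nR dR : ℝ) (i : ℕ) : ℝ :=
  (nR * dR * (dR - 1)) ^ 2 - nR * dR * (dR - 1) * (dR - 1) * (16 * i + 3 * dR ^ 2 + dR + 6)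

/-- `m̲_B(i) = 16 i (d-2) M2 - 16 i d (8 i d + 9 d² + 3 d³)`. -/
noncomputable def mBp (nR dR : ℝ) (i : ℕ) : ℝ :=
  16 * i * (dR - 2) * (nR * dR * (dR - 1)) - 16 * i * dR * (8 * i * dR + 9 * dR ^ 2 + 3 * dR ^ 3)

/-- The system of equations (18)–(21) of the paper determining the type
probabilities `ρ_I, ρ_II` and the (scaled) expected numbers of visits `x_j`,
together with the positivity requirement on the `x_j`. -/
def Sys (nR dR ε : ℝ) (m : ℕ) (x ρI ρII : ℕ → ℝ) : Prop :=
  (∀ j ≤ m, 0 < x j) ∧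
  (∀ i : ℕ, 1 ≤ i → i ≤ m → ρI i = 1 - ε) ∧
  ρI 0 = 0 ∧ ρII 0 = 0 ∧ ρII m = 0 ∧
  (∀ j : ℕ, 1 ≤ j → j + 1 ≤ m →
    x j = 1 + x (j + 1) * ρI (j + 1) * mAp nR dR j / mbarIp nR dR (j + 1)
        + x j * ρI j * mBp nR dR j / mbarIp nR dR j) ∧
  (x m = 1 + x m * ρI m * mBp nR dR m / mbarIp nR dR m) ∧
  (x 0 = 1 + x 1 * ρI 1 * mAp nR dR 0 / mbarIp nR dR 1) ∧
  (∀ j : ℕ, j + 1 ≤ m →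
    ρII j = ρI (j + 1) * (x (j + 1) / x j) * (mbarIIp dR j / mbarIp nR dR (j + 1)))

/-- The explicit unique positive root `x(d)`. -/
noncomputable def xd (dR : ℝ) : ℝ :=
  (7 / 2) * dR - 7 / 2 + 5 / dR +
    (1 / (2 * dR)) * Real.sqrt (65 * dR ^ 4 - 210 * dR ^ 3 + 461 * dR ^ 2 - 412 * dR + 196)

noncomputable instance : Fintype (Pairing n d) := Fintype.ofFinite _

/-- `P` contains every pair in the list `l`. -/
def Contains (P : Pairing n d) (l : List (Point n d × Point n d)) : Prop :=
  ∀ p ∈ l, P.f p.1 = p.2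

/-- The endpoints of a list of pairs. -/
def endpoints {α : Type*} (l : List (α × α)) : List α := l.flatMap fun p => [p.1, p.2]

theorem endpoints_cons {α : Type*} (p : α × α) (l : List (α × α)) :
    endpoints (p :: l) = p.1 :: p.2 :: endpoints l := rfl

theorem length_endpoints {α : Type*} (l : List (α × α)) :
    (endpoints l).length = 2 * l.length := by
  induction l with
  | nil => rfl
  | cons p l ih => simp [endpoints_cons, ih]; ring

theorem mem_endpoints {α : Type*} {l : List (α × α)} {x : α} :
    x ∈ endpoints l ↔ ∃ p ∈ l, x = p.1 ∨ x = p.2 := by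
  simp [endpoints]

theorem conj_injective (τ : Equiv.Perm (Point n d)) :
    Function.Injective fun P : Pairing n d => conj P τ := by
  intro P Q h
  have hf : ∀ x, P.f x = Q.f x := fun x => by
    have := congrFun (congrArg Pairing.f h) (τ x)
    simpa [conj] using this
  cases P; cases Q; congr; exact funext hf

open Classical in
theorem card_contains_cons_mul_le (p : Point n d × Point n d) (l : List (Point n d × Point n d))
    (h : (endpoints (p :: l)).Nodup) :
    (Finset.univ.filter fun P : Pairing n d => Contains P (p :: l)).card *
        (d * n - 2 * (l.length + 1)) ≤
      (Finset.univ.filter fun P : Pairing n d => Contains P l).card := by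
  rw [endpoints_cons, List.nodup_cons, List.nodup_cons] at h
  obtain ⟨h1, h2, h3⟩ := h
  simp only [List.mem_cons, not_or] at h1
  set W : Finset (Point n d) := (p.1 :: endpoints l).toFinsetᶜ
  have hW : d * n - 2 * (l.length + 1) ≤ W.card := by
    have := List.toFinset_card_le (p.1 :: endpoints l)
    rw [List.length_cons, length_endpoints] at this
    rw [Finset.card_compl, Fintype.card_prod, Fintype.card_fin, Fintype.card_fin, mul_comm n d]
    omega
  refine (Nat.mul_le_mul_left _ hW).trans ?_
  rw [← Finset.card_product]
  have key : ∀ P : Pairing n d, Contains P (p :: l) → ∀ z ∈ W,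
      (conj P (Equiv.swap p.2 z)).f p.1 = z := by
    intro P hP z hz
    simp only [W, Finset.mem_compl, List.mem_toFinset, List.mem_cons, not_or] at hz
    have : P.f p.1 = p.2 := hP p (by simp)
    simp [conj, Equiv.swap_apply_of_ne_of_ne h1.1 (Ne.symm hz.1), this]
  refine Finset.card_le_card_of_injOn (fun q => conj q.1 (Equiv.swap p.2 q.2)) ?_ ?_
  · rintro ⟨P, z⟩ hq
    simp only [Finset.coe_product, Set.mem_prod, Finset.mem_coe, Finset.mem_filter,
      Finset.mem_univ, true_and] at hq ⊢
    obtain ⟨hP, hz⟩ := hq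
    simp only [W, Finset.mem_compl, List.mem_toFinset, List.mem_cons, not_or] at hz
    intro q hq
    have e : ∀ x ∈ endpoints l, Equiv.swap p.2 z x = x := fun x hx =>
      Equiv.swap_apply_of_ne_of_ne (fun h => h2 (h ▸ hx)) (fun h => hz.2 (h ▸ hx))
    have hqP : P.f q.1 = q.2 := hP q (by simp [hq])
    simp [conj, e q.1 (mem_endpoints.2 ⟨q, hq, .inl rfl⟩), hqP,
      e q.2 (mem_endpoints.2 ⟨q, hq, .inr rfl⟩)]
  · rintro ⟨P, z⟩ hq ⟨P', z'⟩ hq' heq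
    simp only [Finset.coe_product, Set.mem_prod, Finset.mem_coe, Finset.mem_filter,
      Finset.mem_univ, true_and] at hq hq' heq
    have hz : z = z' := by
      rw [← key P hq.1 z hq.2, heq, key P' hq'.1 z' hq'.2]
    subst hz
    rw [conj_injective _ heq]

open Classical in
theorem card_contains_mul_pow_le (l : List (Point n d × Point n d)) (h : (endpoints l).Nodup) :
    (Finset.univ.filter fun P : Pairing n d => Contains P l).card *
        (d * n - 2 * l.length) ^ l.length ≤ Fintype.card (Pairing n d) := by
  induction l with
  | nil => simpa using Finset.card_le_univ _
  | cons p l ih =>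
    have hl : (endpoints l).Nodup := by
      rw [endpoints_cons] at h; exact h.of_cons.of_cons
    calc _ = (Finset.univ.filter fun P : Pairing n d => Contains P (p :: l)).card *
          (d * n - 2 * (l.length + 1)) * (d * n - 2 * (l.length + 1)) ^ l.length := by
            rw [List.length_cons]; ring
      _ ≤ (Finset.univ.filter fun P : Pairing n d => Contains P l).card *
          (d * n - 2 * l.length) ^ l.length :=
            Nat.mul_le_mul (card_contains_cons_mul_le p l h)
              (Nat.pow_le_pow_left (by omega) _)
      _ ≤ _ := ih hl

/-- First moment bound: the expected number of configurations (lists of `s` disjoint pairs, taken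
from a finite family) contained in a random pairing. -/
theorem sum_mul_pow_le {C : Type*} [Fintype C] (c : C → List (Point n d × Point n d)) (s : ℕ)
    (hs : ∀ e, (c e).length = s) (X : Pairing n d → ℕ)
    (hX : ∀ P, ∃ Z : Finset C, X P ≤ Z.card ∧
      ∀ e ∈ Z, Contains P (c e) ∧ (endpoints (c e)).Nodup) :
    (∑ P, X P) * (d * n - 2 * s) ^ s ≤ Fintype.card C * Fintype.card (Pairing n d) := by
  classical
  choose Z hZ hZc using hX
  have hsum : ∑ P, X P ≤
      ∑ e : C, if (endpoints (c e)).Nodup then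
        (Finset.univ.filter fun P : Pairing n d => Contains P (c e)).card else 0 := by
    calc ∑ P, X P ≤ ∑ P, (Z P).card := Finset.sum_le_sum fun P _ => hZ P
      _ = ∑ P, ∑ e : C, if e ∈ Z P then 1 else 0 := by simp
      _ = ∑ e : C, ∑ P, if e ∈ Z P then 1 else 0 := Finset.sum_comm
      _ ≤ _ := by
        refine Finset.sum_le_sum fun e _ => ?_
        split_ifs with h
        · rw [Finset.card_filter]
          refine Finset.sum_le_sum fun P _ => ?_
          by_cases hP : e ∈ Z P
          · simp [hP, (hZc P e hP).1]
          · simp [hP]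
        · exact (Finset.sum_eq_zero fun P _ => if_neg fun hP => h (hZc P e hP).2).le
  refine (Nat.mul_le_mul_right _ hsum).trans ?_
  rw [Finset.sum_mul]
  refine (Finset.sum_le_card_nsmul _ _ (Fintype.card (Pairing n d)) fun e _ => ?_).trans
    (by simp)
  split_ifs with h
  · have := card_contains_mul_pow_le (c e) h
    rwa [hs] at this
  · simp

theorem endpoints_flatMap {α β : Type*} (l : List β) (c : β → List (α × α)) :
    endpoints (l.flatMap c) = l.flatMap fun e => endpoints (c e) := by
  simp [endpoints, List.flatMap_assoc]

/-- Factorial moment bound for the number of disjoint configurations in a random pairing. -/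
theorem sum_descFactorial_mul_pow_le {C : Type*} [Fintype C]
    (c : C → List (Point n d × Point n d)) (s k : ℕ)
    (hs : ∀ e, (c e).length = s) (X : Pairing n d → ℕ)
    (hX : ∀ P, ∃ Z : Finset C, X P ≤ Z.card ∧
      (∀ e ∈ Z, Contains P (c e) ∧ (endpoints (c e)).Nodup) ∧
      ∀ e ∈ Z, ∀ e' ∈ Z, e ≠ e' → (endpoints (c e)).Disjoint (endpoints (c e'))) :
    (∑ P, (X P).descFactorial k) * (d * n - 2 * (k * s)) ^ (k * s) ≤
      Fintype.card C ^ k * Fintype.card (Pairing n d) := by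
  classical
  have := sum_mul_pow_le (C := Fin k → C) (fun v => (List.ofFn v).flatMap c) (k * s)
    (fun v => by simp [List.length_flatMap, hs, List.map_ofFn, Function.comp_def])
    (fun P => (X P).descFactorial k) ?_
  · simpa using this
  · intro P
    obtain ⟨Z, hZ, hZc, hZd⟩ := hX P
    refine ⟨Finset.univ.image fun v : Fin k ↪ Z => fun i => (v i : C), ?_, ?_⟩
    · rw [Finset.card_image_of_injective, Finset.card_univ, Fintype.card_embedding_eq,
        Fintype.card_coe, Fintype.card_fin]
      · exact Nat.descFactorial_le _ hZ
      · intro v w h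
        ext i
        exact congrFun h i
    · intro e he
      obtain ⟨v, -, rfl⟩ := Finset.mem_image.1 he
      constructor
      · intro p hp
        obtain ⟨x, hx, hp⟩ := List.mem_flatMap.1 hp
        obtain ⟨i, rfl⟩ := (List.mem_ofFn' _ _).1 hx
        exact (hZc _ (v i).2).1 p hp
      · rw [endpoints_flatMap, List.nodup_flatMap]
        constructor
        · intro x hx
          obtain ⟨i, rfl⟩ := (List.mem_ofFn' _ _).1 hx
          exact (hZc _ (v i).2).2
        · rw [List.pairwise_ofFn]
          intro i j hij
          exact hZd _ (v i).2 _ (v j).2 fun h => hij.ne (v.injective (Subtype.ext h))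

open Classical in
theorem card_lt_mul_descFactorial_le (X : Pairing n d → ℕ) (B k : ℕ) :
    (Finset.univ.filter fun P : Pairing n d => B < X P).card * (B + 1 - k) ^ k ≤
      ∑ P, (X P).descFactorial k := by
  have h1 : (B + 1 - k) ^ k ≤ (B + 1).descFactorial k :=
    (Nat.pow_le_pow_left (by omega) _).trans (Nat.pow_sub_le_descFactorial _ _)
  refine (Nat.mul_le_mul_left _ h1).trans ?_
  rw [← smul_eq_mul]
  refine (Finset.card_nsmul_le_sum _ _ _ fun P hP => ?_).trans
    (Finset.sum_le_sum_of_subset (Finset.filter_subset _ _))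
  exact Nat.descFactorial_le _ (Finset.mem_filter.1 hP).2

/-- Tail bound deduced from the factorial moments. -/
theorem card_lt_le_pow_mul {C : Type*} [Fintype C]
    (c : C → List (Point n d × Point n d)) (s k B : ℕ)
    (hs : ∀ e, (c e).length = s) (X : Pairing n d → ℕ)
    (hX : ∀ P, ∃ Z : Finset C, X P ≤ Z.card ∧
      (∀ e ∈ Z, Contains P (c e) ∧ (endpoints (c e)).Nodup) ∧
      ∀ e ∈ Z, ∀ e' ∈ Z, e ≠ e' → (endpoints (c e)).Disjoint (endpoints (c e')))
    (hk : 10 * k ≤ B) (hB : 0 < B) (hM : 20 * (k * s) ≤ d * n) (hM0 : 0 < d * n)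
    (hC : (Fintype.card C : ℝ) ≤ 4 / 5 * ((9 / 10 * B) * (9 / 10 * (d * n)) ^ s)) :
    (Nat.card {P : Pairing n d // B < X P} : ℝ) ≤
      (4 / 5) ^ k * (Nat.card (Pairing n d) : ℝ) := by
  classical
  have h := (Nat.mul_le_mul_right _ (card_lt_mul_descFactorial_le X B k)).trans
    (sum_descFactorial_mul_pow_le c s k hs X hX)
  rw [Nat.card_eq_fintype_card, Nat.card_eq_fintype_card, Fintype.card_subtype]
  set a := (Finset.univ.filter fun P : Pairing n d => B < X P).card
  have h' : (a : ℝ) * ((B + 1 - k : ℕ) : ℝ) ^ k * ((d * n - 2 * (k * s) : ℕ) : ℝ) ^ (k * s) ≤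
      (Fintype.card C : ℝ) ^ k * (Fintype.card (Pairing n d) : ℝ) := by exact_mod_cast h
  have hk' : (10 * k : ℝ) ≤ B := by exact_mod_cast hk
  have hM' : (20 * (k * s) : ℝ) ≤ d * n := by exact_mod_cast hM
  have hB' : (0 : ℝ) < B := by exact_mod_cast hB
  have hM0' : (0 : ℝ) < d * n := by exact_mod_cast hM0
  have b1 : 9 / 10 * (B : ℝ) ≤ ((B + 1 - k : ℕ) : ℝ) := by
    rw [Nat.cast_sub (by omega)]; push_cast; linarith
  have b2 : 9 / 10 * ((d : ℝ) * n) ≤ ((d * n - 2 * (k * s) : ℕ) : ℝ) := by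
    rw [Nat.cast_sub (by omega)]; push_cast; linarith
  set Y : ℝ := (9 / 10 * B) * (9 / 10 * ((d : ℝ) * n)) ^ s with hY
  have hYpos : 0 < Y := by positivity
  refine le_of_mul_le_mul_right ?_ (pow_pos hYpos k)
  calc (a : ℝ) * Y ^ k = a * (9 / 10 * (B : ℝ)) ^ k * (9 / 10 * ((d : ℝ) * n)) ^ (k * s) := by
        rw [hY, mul_pow, ← pow_mul, mul_comm s k]; ring
    _ ≤ a * ((B + 1 - k : ℕ) : ℝ) ^ k * ((d * n - 2 * (k * s) : ℕ) : ℝ) ^ (k * s) := by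
        gcongr
    _ ≤ _ := h'
    _ ≤ (4 / 5 * Y) ^ k * (Fintype.card (Pairing n d) : ℝ) := by gcongr
    _ = _ := by rw [mul_pow]; ring

theorem Pairing.f_injective (P : Pairing n d) : Function.Injective P.f :=
  Function.LeftInverse.injective P.invol

/-- The number of loops is bounded by a number of disjoint one-pair configurations. -/
theorem exists_loop_configs (P : Pairing n d) :
    ∃ Z : Finset (Fin n × Fin d × Fin d), numLoops P ≤ Z.card ∧
      (∀ e ∈ Z, Contains P [((e.1, e.2.1), (e.1, e.2.2))] ∧
        (endpoints [((e.1, e.2.1), (e.1, e.2.2))]).Nodup) ∧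
      ∀ e ∈ Z, ∀ e' ∈ Z, e ≠ e' → (endpoints [((e.1, e.2.1), (e.1, e.2.2))]).Disjoint
        (endpoints [((e'.1, e'.2.1), (e'.1, e'.2.2))]) := by
  classical
  refine ⟨Finset.univ.filter fun e => P.f (e.1, e.2.1) = (e.1, e.2.2) ∧ e.2.1 < e.2.2,
    ?_, ?_, ?_⟩
  · set Z : Finset (Fin n × Fin d × Fin d) :=
      Finset.univ.filter fun e => P.f (e.1, e.2.1) = (e.1, e.2.2) ∧ e.2.1 < e.2.2 with hZ
    have hsub : (Finset.univ.filter fun a : Point n d => (P.f a).1 = a.1) ⊆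
        Z.image (fun e => (e.1, e.2.1)) ∪ Z.image (fun e => (e.1, e.2.2)) := by
      intro a ha
      replace ha : (P.f a).1 = a.1 := by simpa using ha
      have hne : a.2 ≠ (P.f a).2 := fun h => P.nofix a (Prod.ext ha h.symm)
      rw [Finset.mem_union, Finset.mem_image, Finset.mem_image]
      rcases lt_or_gt_of_ne hne with h | h
      · refine .inl ⟨(a.1, a.2, (P.f a).2), ?_, rfl⟩
        simp only [hZ, Finset.mem_filter, Finset.mem_univ, true_and]
        exact ⟨Prod.ext ha rfl, h⟩
      · refine .inr ⟨(a.1, (P.f a).2, a.2), ?_, rfl⟩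
        simp only [hZ, Finset.mem_filter, Finset.mem_univ, true_and]
        refine ⟨?_, h⟩
        have : ((a.1, (P.f a).2) : Point n d) = P.f a := Prod.ext ha.symm rfl
        rw [this, P.invol]
    have h1 := (Finset.card_le_card hsub).trans (Finset.card_union_le _ _)
    have h2 := Finset.card_image_le (s := Z) (f := fun e => ((e.1, e.2.1) : Point n d))
    have h3 := Finset.card_image_le (s := Z) (f := fun e => ((e.1, e.2.2) : Point n d))
    rw [numLoops]
    omega
  · intro e he
    simp only [Finset.mem_filter, Finset.mem_univ, true_and] at he
    simp [Contains, endpoints, he.1, he.2.ne]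
  · rintro ⟨u, i, j⟩ he ⟨u', i', j'⟩ he' hne x hx hx'
    simp only [Finset.mem_filter, Finset.mem_univ, true_and] at he he'
    simp only [endpoints, List.flatMap_cons, List.flatMap_nil, List.append_nil, List.mem_cons,
      List.not_mem_nil, or_false] at hx hx'
    have hinv : P.f (u, j) = (u, i) := by rw [← he.1, P.invol]
    have hinv' : P.f (u', j') = (u', i') := by rw [← he'.1, P.invol]
    have := he.2
    have := he'.2
    apply hne
    rcases hx with rfl | rfl <;> rcases hx' with h | h <;>
      simp only [Prod.mk.injEq] at h ⊢ <;> obtain ⟨rfl, rfl⟩ := h <;> grind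

/-- Configurations of `r` parallel pairs. -/
abbrev EdgeConfig (n d r : ℕ) :=
  {q : Fin n × Fin n // q.1 < q.2} × (Fin r ↪ Fin d) × (Fin r ↪ Fin d)

/-- The pairs of a configuration of parallel pairs. -/
def EdgeConfig.pairs {r : ℕ} (e : EdgeConfig n d r) : List (Point n d × Point n d) :=
  List.ofFn fun i => ((e.1.1.1, e.2.1 i), (e.1.1.2, e.2.2 i))

theorem EdgeConfig.length_pairs {r : ℕ} (e : EdgeConfig n d r) : e.pairs.length = r := by
  simp [pairs]

theorem EdgeConfig.nodup_endpoints {r : ℕ} (e : EdgeConfig n d r) :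
    (endpoints e.pairs).Nodup := by
  have hne := e.1.2.ne
  rw [endpoints, List.nodup_flatMap]
  constructor
  · intro p hp
    obtain ⟨i, rfl⟩ := (List.mem_ofFn' _ _).1 hp
    simp [hne]
  · rw [pairs, List.pairwise_ofFn]
    intro i j hij x hx hx'
    simp only [List.mem_cons, List.not_mem_nil, or_false] at hx hx'
    rcases hx with rfl | rfl <;> rcases hx' with h | h <;> simp at h
    · exact hij.ne h
    · exact hne h.1
    · exact hne h.1.symm
    · exact hij.ne h

theorem EdgeConfig.contains_iff {r : ℕ} (e : EdgeConfig n d r) (P : Pairing n d) :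
    Contains P e.pairs ↔ ∀ i, P.f (e.1.1.1, e.2.1 i) = (e.1.1.2, e.2.2 i) := by
  simp [Contains, pairs, List.mem_ofFn']

theorem two_mul_card_lt_le (n : ℕ) :
    2 * Fintype.card {q : Fin n × Fin n // q.1 < q.2} ≤ n * n := by
  have h : Fintype.card ({q : Fin n × Fin n // q.1 < q.2} ⊕ {q : Fin n × Fin n // q.1 < q.2}) ≤
      Fintype.card (Fin n × Fin n) := by
    refine Fintype.card_le_of_injective
      (Sum.elim (fun q => q.1) (fun q => q.1.swap)) ?_
    rintro (⟨⟨a, b⟩, h⟩ | ⟨⟨a, b⟩, h⟩) (⟨⟨a', b'⟩, h'⟩ | ⟨⟨a', b'⟩, h'⟩) heq <;>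
      simp at heq h h' ⊢ <;> grind
  simpa [two_mul] using h

theorem exists_embedding_of_mult_eq (P : Pairing n d) {u w : Fin n} {r : ℕ}
    (h : mult P u w = r) :
    ∃ g g' : Fin r ↪ Fin d, ∀ i, P.f (u, g i) = (w, g' i) := by
  classical
  let φ := (Finset.univ.filter fun a : Point n d => a.1 = u ∧ (P.f a).1 = w).equivFinOfCardEq h
  have hφ : ∀ i, ((φ.symm i : Point n d)).1 = u ∧ (P.f (φ.symm i)).1 = w := fun i =>
    (Finset.mem_filter.1 (φ.symm i).2).2
  refine ⟨⟨fun i => (φ.symm i : Point n d).2, fun i j hij => ?_⟩,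
    ⟨fun i => (P.f (φ.symm i)).2, fun i j hij => ?_⟩, fun i => ?_⟩
  · exact φ.symm.injective (Subtype.ext (Prod.ext ((hφ i).1.trans (hφ j).1.symm) hij))
  · exact φ.symm.injective (Subtype.ext (P.f_injective
      (Prod.ext ((hφ i).2.trans (hφ j).2.symm) hij)))
  · have : ((u, (φ.symm i : Point n d).2) : Point n d) = φ.symm i := Prod.ext (hφ i).1.symm rfl
    change P.f (u, (φ.symm i : Point n d).2) = _
    rw [this]
    exact Prod.ext (hφ i).2 rfl

theorem card_subtype_mult_eq (P : Pairing n d) (r : ℕ) :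
    edgesWithMult P r =
      Fintype.card {q : {q : Fin n × Fin n // q.1 < q.2} // mult P q.1.1 q.1.2 = r} := by
  classical
  rw [edgesWithMult, ← Fintype.card_subtype]
  exact Fintype.card_congr (Equiv.subtypeSubtypeEquivSubtypeInter
    (fun q : Fin n × Fin n => q.1 < q.2) (fun q => mult P q.1 q.2 = r)).symm

/-- An edge of multiplicity `r` carries `r!` configurations. -/
theorem exists_ordered_edge_configs (P : Pairing n d) (r : ℕ) :
    ∃ Z : Finset (EdgeConfig n d r), r.factorial * edgesWithMult P r ≤ Z.card ∧
      ∀ e ∈ Z, Contains P e.pairs ∧ (endpoints e.pairs).Nodup := by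
  classical
  choose g g' hg using fun q : {q : {q : Fin n × Fin n // q.1 < q.2} //
    mult P q.1.1 q.1.2 = r} => exists_embedding_of_mult_eq P q.2
  refine ⟨Finset.univ.image fun t : Equiv.Perm (Fin r) × _ =>
    ((t.2.1, t.1.toEmbedding.trans (g t.2), t.1.toEmbedding.trans (g' t.2)) :
      EdgeConfig n d r), ?_, ?_⟩
  · rw [Finset.card_image_of_injective, Finset.card_univ, Fintype.card_prod, Fintype.card_perm,
      Fintype.card_fin, card_subtype_mult_eq]
    rintro ⟨σ, q⟩ ⟨σ', q'⟩ h
    simp only [Prod.mk.injEq] at h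
    obtain ⟨h1, h2, -⟩ := h
    have hq : q = q' := Subtype.ext h1
    subst hq
    have : σ = σ' := Equiv.ext fun i => (g q).injective (DFunLike.congr_fun h2 i)
    rw [this]
  · intro e he
    obtain ⟨⟨σ, q⟩, -, rfl⟩ := Finset.mem_image.1 he
    exact ⟨(EdgeConfig.contains_iff _ _).2 fun i => hg q (σ i), EdgeConfig.nodup_endpoints _⟩

/-- The edges of multiplicity `r` give disjoint configurations. -/
theorem exists_disjoint_edge_configs (P : Pairing n d) (r : ℕ) :
    ∃ Z : Finset (EdgeConfig n d r), edgesWithMult P r ≤ Z.card ∧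
      (∀ e ∈ Z, Contains P e.pairs ∧ (endpoints e.pairs).Nodup) ∧
      ∀ e ∈ Z, ∀ e' ∈ Z, e ≠ e' → (endpoints e.pairs).Disjoint (endpoints e'.pairs) := by
  classical
  choose g g' hg using fun q : {q : {q : Fin n × Fin n // q.1 < q.2} //
    mult P q.1.1 q.1.2 = r} => exists_embedding_of_mult_eq P q.2
  have hbins : ∀ q, ∀ x ∈ endpoints (EdgeConfig.pairs ((q.1, g q, g' q) : EdgeConfig n d r)),
      (x.1 = q.1.1.1 ∧ (P.f x).1 = q.1.1.2) ∨ (x.1 = q.1.1.2 ∧ (P.f x).1 = q.1.1.1) := by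
    intro q x hx
    obtain ⟨p, hp, hx⟩ := mem_endpoints.1 hx
    obtain ⟨i, rfl⟩ := (List.mem_ofFn' _ _).1 hp
    rcases hx with rfl | rfl
    · exact .inl ⟨rfl, by simp [hg]⟩
    · exact .inr ⟨rfl, by simp [← hg, P.invol]⟩
  refine ⟨Finset.univ.image fun q => ((q.1, g q, g' q) : EdgeConfig n d r), ?_, ?_, ?_⟩
  · rw [Finset.card_image_of_injective, Finset.card_univ, card_subtype_mult_eq]
    intro q q' h
    exact Subtype.ext (Prod.ext_iff.1 h).1
  · intro e he
    obtain ⟨q, -, rfl⟩ := Finset.mem_image.1 he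
    exact ⟨(EdgeConfig.contains_iff _ _).2 (hg q), EdgeConfig.nodup_endpoints _⟩
  · intro e he e' he' hne x hx hx'
    obtain ⟨q, -, rfl⟩ := Finset.mem_image.1 he
    obtain ⟨q', -, rfl⟩ := Finset.mem_image.1 he'
    have hqq : q ≠ q' := fun h => hne (by rw [h])
    apply hqq
    have h1 := q.1.2
    have h2 := q'.1.2
    refine Subtype.ext (Subtype.ext (Prod.ext ?_ ?_)) <;>
      rcases hbins q x hx with h | h <;> rcases hbins q' x hx' with h' | h' <;> grind

theorem card_edgeConfig (n d r : ℕ) :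
    Fintype.card (EdgeConfig n d r) =
      Fintype.card {q : Fin n × Fin n // q.1 < q.2} * d.descFactorial r ^ 2 := by
  simp [EdgeConfig, Fintype.card_embedding_eq, sq]

theorem le_toNat_ceil (x : ℝ) : x ≤ (⌈x⌉.toNat : ℝ) :=
  (Int.le_ceil x).trans (by exact_mod_cast Int.self_le_toNat _)

theorem card_BL_lt_le (k : ℕ) (hk : (10 * k : ℝ) ≤ Real.log (d * n)) (hd : 1 ≤ d)
    (hM : 20 * k ≤ d * n) (hn : 0 < n) :
    (Nat.card {P : Pairing n d // BL n d < numLoops P} : ℝ) ≤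
      (4 / 5) ^ k * (Nat.card (Pairing n d) : ℝ) := by
  have hB : 4 * d ≤ BL n d := le_max_right _ _
  have hB' : (4 * d : ℝ) ≤ BL n d := by exact_mod_cast hB
  have hlog : Real.log (d * n) ≤ BL n d :=
    (le_toNat_ceil _).trans (Nat.cast_le.2 (le_max_left _ _))
  refine card_lt_le_pow_mul (fun e : Fin n × Fin d × Fin d => [((e.1, e.2.1), (e.1, e.2.2))]) 1 k
    (BL n d) (fun _ => rfl) _ exists_loop_configs (by exact_mod_cast hk.trans hlog) (by omega)
    (by simpa using hM) (by positivity) ?_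
  simp only [Fintype.card_prod, Fintype.card_fin, pow_one]
  push_cast
  have : (4 * d : ℝ) * (d * n) ≤ BL n d * (d * n) := by gcongr
  have : (0 : ℝ) ≤ d * (d * n) := by positivity
  nlinarith

theorem card_BT_lt_le (k : ℕ) (hk : (10 * k : ℝ) ≤ Real.log (d * n)) (hk0 : 0 < k) (hd : 1 ≤ d)
    (hM : 60 * k ≤ d * n) (hn : 0 < n) :
    (Nat.card {P : Pairing n d // BT n d < edgesWithMult P 3} : ℝ) ≤
      (4 / 5) ^ k * (Nat.card (Pairing n d) : ℝ) := by
  have hB : (d : ℝ) ^ 3 / n ≤ BT n d :=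
    (le_toNat_ceil _).trans (Nat.cast_le.2 (le_max_right _ _))
  have hlog : Real.log (d * n) ≤ BT n d :=
    (le_toNat_ceil _).trans (Nat.cast_le.2 (le_max_left _ _))
  have hkB : 10 * k ≤ BT n d := by exact_mod_cast hk.trans hlog
  refine card_lt_le_pow_mul (C := EdgeConfig n d 3) EdgeConfig.pairs 3 k
    (BT n d) EdgeConfig.length_pairs _ (fun P => exists_disjoint_edge_configs P 3) hkB (by omega)
    (by omega) (by positivity) ?_
  have hn' : (0 : ℝ) < n := by exact_mod_cast hn
  have hcard : (Fintype.card {q : Fin n × Fin n // q.1 < q.2} : ℝ) ≤ n ^ 2 / 2 := by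
    have : (2 * Fintype.card {q : Fin n × Fin n // q.1 < q.2} : ℝ) ≤ n * n := by
      exact_mod_cast two_mul_card_lt_le n
    linarith
  have hdesc : (d.descFactorial 3 : ℝ) ≤ d ^ 3 := by
    exact_mod_cast Nat.descFactorial_le_pow d 3
  have hB2 : (d : ℝ) ^ 6 * n ^ 2 ≤ BT n d * (d * n) ^ 3 := by
    calc (d : ℝ) ^ 6 * n ^ 2 = (d : ℝ) ^ 3 / n * (d * n) ^ 3 := by field_simp
      _ ≤ _ := by gcongr
  rw [card_edgeConfig]
  push_cast
  calc _ ≤ (n : ℝ) ^ 2 / 2 * (d ^ 3) ^ 2 := by gcongr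
    _ ≤ _ := by
      have : (0 : ℝ) ≤ (d : ℝ) ^ 6 * n ^ 2 := by positivity
      nlinarith

theorem card_BD_lt_mul_le (γ : ℝ) (hγ : 0 < γ) (hd : 1 ≤ d) (hM : 4 < d * n) :
    (Nat.card {P : Pairing n d // BD d γ < edgesWithMult P 2} : ℝ) ≤
      1 / (1 + γ) * ((d * n : ℝ) / (d * n - 4)) ^ 2 * (Nat.card (Pairing n d) : ℝ) := by
  classical
  have h := sum_mul_pow_le (C := EdgeConfig n d 2) EdgeConfig.pairs 2
    EdgeConfig.length_pairs (fun P => Nat.factorial 2 * edgesWithMult P 2)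
    (fun P => exists_ordered_edge_configs P 2)
  rw [card_edgeConfig] at h
  have hM' : (0 : ℝ) < d * n - 4 := by
    have : (4 : ℝ) < d * n := by exact_mod_cast hM
    linarith
  have hdesc : (d.descFactorial 2 : ℝ) = d * (d - 1) := by
    rw [Nat.descFactorial_succ, Nat.descFactorial_one, Nat.cast_mul, Nat.cast_sub hd]
    push_cast; ring
  have hcard : (Fintype.card {q : Fin n × Fin n // q.1 < q.2} : ℝ) ≤ n ^ 2 / 2 := by
    have : (2 * Fintype.card {q : Fin n × Fin n // q.1 < q.2} : ℝ) ≤ n * n := by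
      exact_mod_cast two_mul_card_lt_le n
    linarith
  set N := Fintype.card (Pairing n d) with hN
  have h' : (2 * ∑ P : Pairing n d, (edgesWithMult P 2 : ℝ)) * (d * n - 4) ^ 2 ≤
      n ^ 2 / 2 * (d * (d - 1)) ^ 2 * N := by
    have h2 : ((∑ P : Pairing n d, Nat.factorial 2 * edgesWithMult P 2 : ℕ) : ℝ) *
        ((d * n - 2 * 2 : ℕ) : ℝ) ^ 2 ≤
        Fintype.card {q : Fin n × Fin n // q.1 < q.2} * (d.descFactorial 2 : ℝ) ^ 2 * N := by
      exact_mod_cast h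
    rw [Nat.cast_sub (by omega), hdesc] at h2
    simp only [Nat.factorial_two, Nat.cast_sum, Nat.cast_mul, ← Finset.mul_sum] at h2
    norm_num at h2
    refine h2.trans ?_
    gcongr
  rw [Nat.card_eq_fintype_card, Nat.card_eq_fintype_card, Fintype.card_subtype]
  set a := (Finset.univ.filter fun P : Pairing n d => BD d γ < edgesWithMult P 2).card
  have hmarkov : ∀ t : ℝ, (∀ P : Pairing n d, BD d γ < edgesWithMult P 2 →
      t ≤ edgesWithMult P 2) → a * t ≤ ∑ P : Pairing n d, (edgesWithMult P 2 : ℝ) := by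
    intro t ht
    rw [← nsmul_eq_mul]
    refine (Finset.card_nsmul_le_sum _ _ _ fun P hP => ht P (Finset.mem_filter.1 hP).2).trans
      (Finset.sum_le_sum_of_subset_of_nonneg (Finset.filter_subset _ _) fun _ _ _ => by positivity)
  rcases hd.eq_or_lt with hd1 | hd2
  · have ha := hmarkov 1 fun P hP => by exact_mod_cast Nat.one_le_of_lt hP
    have h0 : (d : ℝ) - 1 = 0 := by rw [← hd1]; simp
    rw [h0] at h'
    have : (a : ℝ) ≤ 0 := by
      by_contra hcon
      have : 0 < (2 * ∑ P : Pairing n d, (edgesWithMult P 2 : ℝ)) * ((d : ℝ) * n - 4) ^ 2 := by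
        have : 0 < ∑ P : Pairing n d, (edgesWithMult P 2 : ℝ) := by linarith
        positivity
      linarith
    exact this.trans (by positivity)
  · have ha := hmarkov ((1 + γ) * ((d : ℝ) - 1) ^ 2 / 4) fun P hP => by
      have h1 : ⌊(1 + γ) * ((d : ℝ) - 1) ^ 2 / 4⌋ < (edgesWithMult P 2 : ℤ) :=
        (Int.self_le_toNat _).trans_lt (Nat.cast_lt.2 hP)
      exact_mod_cast (Int.floor_lt.1 h1).le
    have hd' : (0 : ℝ) < (d : ℝ) - 1 := by
      have : (1 : ℝ) < d := by exact_mod_cast hd2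
      linarith
    have hfin : (a : ℝ) * (1 + γ) * (d * n - 4) ^ 2 * (d - 1) ^ 2 ≤
        (d * n) ^ 2 * N * (d - 1) ^ 2 := by
      nlinarith [mul_le_mul_of_nonneg_right ha (sq_nonneg ((d : ℝ) * n - 4))]
    have hfin' := le_of_mul_le_mul_right hfin (by positivity)
    rw [div_pow, one_div, ← div_eq_inv_mul, div_div, div_mul_eq_mul_div, le_div_iff₀ (by positivity)]
    linarith

theorem card_not_mem_AccSet_le (γ : ℝ) :
    Nat.card {P : Pairing n d // P ∉ AccSet n d γ} ≤
      Nat.card {P : Pairing n d // BD d γ < edgesWithMult P 2} +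
      Nat.card {P : Pairing n d // BL n d < numLoops P} +
      Nat.card {P : Pairing n d // BT n d < edgesWithMult P 3} := by
  classical
  simp only [Nat.card_eq_fintype_card, Fintype.card_subtype]
  refine (Finset.card_le_card ?_).trans ((Finset.card_union_le _ _).trans
    (Nat.add_le_add_right (Finset.card_union_le _ _) _))
  intro P hP
  simp only [Finset.mem_filter, Finset.mem_univ, true_and,
    Finset.mem_union] at hP ⊢
  by_contra! h
  exact hP ⟨h.1.1, h.1.2, h.2⟩

/-- Lemma 4: the probability of an initial rejection is at most
`1/(1+γ) + o(1)`, i.e. the limsup (over `n` with `d(n)·n` even) of the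
probability that a uniformly random pairing is not in `A` is at most `1/(1+γ)`. -/
theorem stmt_8 (γ : ℝ) (hγ : 0 < γ) (d : ℕ → ℕ) (hd : ∀ n, 1 ≤ d n)
    (hdo : Filter.Tendsto (fun n : ℕ => (d n : ℝ) / Real.sqrt n) Filter.atTop
      (nhds 0)) :
    Filter.limsup
      (fun n : ℕ =>
        (Nat.card {P : Pairing n (d n) // P ∉ AccSet n (d n) γ} : ℝ) /
          (Nat.card (Pairing n (d n)) : ℝ))
      (Filter.atTop ⊓ Filter.principal {n : ℕ | Even (d n * n)}) ≤ 1 / (1 + γ) := by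
  have hbot : (Filter.atTop ⊓ Filter.principal {n : ℕ | Even (d n * n)}).NeBot := by
    rw [← Filter.frequently_mem_iff_neBot, Filter.frequently_atTop]
    exact fun a => ⟨2 * a, by omega, (even_two_mul a).mul_left _⟩
  refine le_of_forall_pos_le_add fun ε hε => ?_
  refine Filter.limsup_le_of_le
    (Filter.isCoboundedUnder_le_of_le _ (x := 0) fun n => by positivity) ?_
  refine Filter.Eventually.filter_mono inf_le_left ?_
  have hM : Filter.Tendsto (fun n : ℕ => (d n : ℝ) * n) Filter.atTop Filter.atTop := by
    refine Filter.tendsto_atTop_mono (fun n => ?_) tendsto_natCast_atTop_atTop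
    have : (1 : ℝ) ≤ d n := by exact_mod_cast hd n
    nlinarith [Nat.cast_nonneg (α := ℝ) n]
  obtain ⟨k, hk⟩ := exists_pow_lt_of_lt_one (show 0 < ε / 3 by positivity)
    (show (4 / 5 : ℝ) < 1 by norm_num)
  have hk' : (4 / 5 : ℝ) ^ (k + 1) < ε / 3 :=
    (pow_le_pow_of_le_one (by norm_num) (by norm_num) (Nat.le_succ k)).trans_lt hk
  have hratio : Filter.Tendsto (fun x : ℝ => 1 / (1 + γ) * (x / (x - 4)) ^ 2) Filter.atTop
      (nhds (1 / (1 + γ))) := by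
    have h1 : Filter.Tendsto (fun x : ℝ => 1 + 4 / (x - 4)) Filter.atTop (nhds (1 + 0)) :=
      tendsto_const_nhds.add
        (tendsto_const_nhds.div_atTop (Filter.tendsto_atTop_add_const_right _ _ Filter.tendsto_id))
    have h2 : Filter.Tendsto (fun x : ℝ => x / (x - 4)) Filter.atTop (nhds 1) := by
      rw [add_zero] at h1
      refine h1.congr' ?_
      filter_upwards [Filter.eventually_gt_atTop 4] with x hx
      have : x - 4 ≠ 0 := by linarith
      field_simp
      ring
    simpa using (h2.pow 2).const_mul (1 / (1 + γ))
  filter_upwards [Filter.eventually_gt_atTop 0,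
    hM.eventually (hratio.eventually_le_const
      (show 1 / (1 + γ) < 1 / (1 + γ) + ε / 3 by linarith)),
    hM.eventually_ge_atTop ((60 * (k + 1) : ℕ) : ℝ),
    (Real.tendsto_log_atTop.comp hM).eventually_ge_atTop ((10 * (k + 1 : ℕ) : ℝ))]
    with n hn hr hMn hlog
  have hMn' : 60 * (k + 1) ≤ d n * n := by exact_mod_cast hMn
  have hD := card_BD_lt_mul_le (n := n) γ hγ (hd n) (by omega)
  have hL := card_BL_lt_le (n := n) (k + 1) hlog (hd n) (by omega) hn
  have hT := card_BT_lt_le (n := n) (k + 1) hlog (by omega) (hd n) hMn' hn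
  have hA : (Nat.card {P : Pairing n (d n) // P ∉ AccSet n (d n) γ} : ℝ) ≤ _ :=
    Nat.cast_le.2 (card_not_mem_AccSet_le γ)
  push_cast at hA
  refine div_le_of_le_mul₀ (by positivity) (by positivity) ?_
  have hN : (0 : ℝ) ≤ Nat.card (Pairing n (d n)) := by positivity
  have e1 := mul_le_mul_of_nonneg_right hr hN
  have e2 := mul_le_mul_of_nonneg_right hk'.le hN
  linarith

end Reg
end

section
/- Let n, d be positive integers with dn even and fix a constant γ > 0. For every i ≥ 0 and every pairing P ∈ S^T_i: (i) the number of type T switchings on P satisfies f_T(P) ≤ 12i·M1³; and (ii) if 0 ≤ i ≤ B_T − 1, then b_A^T(P) ≥ M3² − 4·M3·d²·(6B_D + 9i + 4d + d²). -/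
/-!
Formalization of the pairing model of random `d`-regular (multi)graphs and of the
switchings used in the uniform sampler *REG* of Gao and Wormald,
"Uniform generation of random regular graphs".

Bins are elements of `Fin n`; each bin contains `d` points, so points are
elements of `Fin n × Fin d`.  A pairing is a perfect matching of the points,
modelled as a fixed-point-free involution on the points: the pairs of the
pairing are the orbits `{x, P.f x}`.
-/

namespace Reg

variable {n d : ℕ}

/-- `1` if the bin-pair `{p, q}` is `{x, y}` (for `x ≠ y`), and `0` otherwise. -/
def joinInd (x y p q : Fin n) : ℕ :=
  (if p = x ∧ q = y then 1 else 0) + (if q = x ∧ p = y then 1 else 0)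

lemma mult_comm (P : Pairing n d) (u v : Fin n) : mult P u v = mult P v u := by
  unfold mult
  refine Finset.card_bij' (fun a _ => P.f a) (fun a _ => P.f a) ?_ ?_ ?_ ?_ <;>
    simp +contextual [P.invol]

lemma mult_f_pos (P : Pairing n d) (a : Point n d) : 1 ≤ mult P a.1 (P.f a).1 :=
  Finset.card_pos.2 ⟨a, by simp⟩

lemma mult_eq_sum (P : Pairing n d) (x y : Fin n) :
    mult P x y = ∑ a : Point n d, if a.1 = x ∧ (P.f a).1 = y then 1 else 0 := by
  rw [mult, Finset.card_filter]

lemma conj_symm_conj (P : Pairing n d) (τ : Equiv.Perm (Point n d)) :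
    conj (conj P τ.symm) τ = P := by
  cases P
  simp [conj]

lemma conj_swap_f_of_ne (P : Pairing n d) {a b z : Point n d}
    (ha : z ≠ a) (hb : z ≠ b) (hfa : z ≠ P.f a) (hfb : z ≠ P.f b) :
    (conj P (Equiv.swap a b)).f z = P.f z := by
  have h1 : P.f z ≠ a := fun h => hfa (by rw [← h, P.invol])
  have h2 : P.f z ≠ b := fun h => hfb (by rw [← h, P.invol])
  simp [conj, Equiv.swap_apply_of_ne_of_ne, *]

lemma mult_conj_swap (P : Pairing n d) {a b : Point n d} (hab : a ≠ b) (h : P.f a ≠ b)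
    (x y : Fin n) :
    mult (conj P (Equiv.swap a b)) x y + joinInd x y a.1 (P.f a).1 + joinInd x y b.1 (P.f b).1 =
      mult P x y + joinInd x y b.1 (P.f a).1 + joinInd x y a.1 (P.f b).1 := by
  have h' : P.f b ≠ a := fun e => h (by rw [← e, P.invol])
  have haa := P.nofix a
  have hbb := P.nofix b
  have hff : P.f a ≠ P.f b := fun e => hab (by rw [← P.invol a, e, P.invol])
  have key : ∀ g : Point n d → Point n d,
      (∑ z : Point n d, if z.1 = x ∧ (g z).1 = y then 1 else 0) =
        (∑ z ∈ ({a, b, P.f a, P.f b} : Finset (Point n d))ᶜ,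
          if z.1 = x ∧ (g z).1 = y then 1 else 0) +
        ∑ z ∈ ({a, b, P.f a, P.f b} : Finset (Point n d)),
          if z.1 = x ∧ (g z).1 = y then 1 else 0 := fun g =>
    (Finset.sum_compl_add_sum _ _).symm
  rw [mult_eq_sum, mult_eq_sum, key, key]
  have hrest : (∑ z ∈ ({a, b, P.f a, P.f b} : Finset (Point n d))ᶜ,
        if z.1 = x ∧ ((conj P (Equiv.swap a b)).f z).1 = y then 1 else 0) =
      ∑ z ∈ ({a, b, P.f a, P.f b} : Finset (Point n d))ᶜ,
        if z.1 = x ∧ (P.f z).1 = y then 1 else 0 := by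
    refine Finset.sum_congr rfl fun z hz => ?_
    simp only [Finset.mem_compl, Finset.mem_insert, Finset.mem_singleton, not_or] at hz
    rw [conj_swap_f_of_ne P hz.1 hz.2.1 hz.2.2.1 hz.2.2.2]
  have e1 : (conj P (Equiv.swap a b)).f a = P.f b := by
    simp [conj, Equiv.swap_apply_of_ne_of_ne, *]
  have e2 : (conj P (Equiv.swap a b)).f b = P.f a := by
    simp [conj, Equiv.swap_apply_of_ne_of_ne, *]
  have e3 : (conj P (Equiv.swap a b)).f (P.f a) = b := by
    simp [conj, Equiv.swap_apply_of_ne_of_ne, P.invol, *]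
  have e4 : (conj P (Equiv.swap a b)).f (P.f b) = a := by
    simp [conj, Equiv.swap_apply_of_ne_of_ne, P.invol, *]
  have n1 : a ∉ ({b, P.f a, P.f b} : Finset (Point n d)) := by
    simp [hab, haa.symm, h'.symm]
  have n2 : b ∉ ({P.f a, P.f b} : Finset (Point n d)) := by
    simp [h.symm, hbb.symm]
  have n3 : P.f a ∉ ({P.f b} : Finset (Point n d)) := by simp [hff]
  rw [hrest]
  simp only [Finset.sum_insert n1, Finset.sum_insert n2, Finset.sum_insert n3,
    Finset.sum_singleton, e1, e2, e3, e4, P.invol, joinInd]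
  ring

lemma f_bin_ne_of_numLoops (P : Pairing n d) (h : numLoops P = 0) (a : Point n d) :
    (P.f a).1 ≠ a.1 := by
  intro ha
  have h1 : ({a, P.f a} : Finset (Point n d)) ⊆
      Finset.univ.filter fun a : Point n d => (P.f a).1 = a.1 := by
    intro z hz
    simp only [Finset.mem_insert, Finset.mem_singleton] at hz
    rcases hz with rfl | rfl <;> simp [P.invol, ha]
  have h2 := Finset.card_le_card h1
  rw [Finset.card_pair (P.nofix a).symm] at h2
  unfold numLoops at h
  omega

lemma numLoops_eq_zero (P : Pairing n d) (h : ∀ a, (P.f a).1 ≠ a.1) : numLoops P = 0 := by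
  simp [numLoops, h]

/-- The ordered pairs of distinct bins joined by exactly `k` pairs. -/
def orderedEdges (P : Pairing n d) (k : ℕ) : Finset (Fin n × Fin n) :=
  Finset.univ.filter fun q => q.1 ≠ q.2 ∧ mult P q.1 q.2 = k

lemma card_orderedEdges (P : Pairing n d) (k : ℕ) :
    (orderedEdges P k).card = 2 * edgesWithMult P k := by
  have h1 : orderedEdges P k =
      (Finset.univ.filter fun q : Fin n × Fin n => q.1 < q.2 ∧ mult P q.1 q.2 = k) ∪
      (Finset.univ.filter fun q : Fin n × Fin n => q.2 < q.1 ∧ mult P q.1 q.2 = k) := by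
    ext q
    simp only [orderedEdges, Finset.mem_filter, Finset.mem_univ, true_and, Finset.mem_union,
      ne_iff_lt_or_gt]
    tauto
  have h2 : (Finset.univ.filter fun q : Fin n × Fin n => q.2 < q.1 ∧ mult P q.1 q.2 = k).card =
      edgesWithMult P k := by
    unfold edgesWithMult
    refine Finset.card_bij' (fun q _ => q.swap) (fun q _ => q.swap) ?_ ?_ ?_ ?_ <;>
      simp +contextual [mult_comm P]
  rw [h1, Finset.card_union_of_disjoint, h2, edgesWithMult, two_mul]
  rw [Finset.disjoint_filter]
  rintro q - ⟨h, -⟩ ⟨h', -⟩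
  exact absurd h h'.asymm

lemma card_points_of_mult (P : Pairing n d) (hl : ∀ a, (P.f a).1 ≠ a.1) (k : ℕ) :
    (Finset.univ.filter fun a : Point n d => mult P a.1 (P.f a).1 = k).card =
      2 * k * edgesWithMult P k := by
  rw [Finset.card_eq_sum_card_fiberwise (f := fun a => (a.1, (P.f a).1))
    (t := orderedEdges P k)]
  · rw [Finset.sum_congr rfl (g := fun _ => k), Finset.sum_const, card_orderedEdges, smul_eq_mul]
    · ring
    · rintro ⟨x, y⟩ hq
      simp only [orderedEdges, Finset.mem_filter, Finset.mem_univ, true_and] at hq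
      refine Eq.trans ?_ hq.2
      rw [mult, Finset.filter_filter]
      congr 1
      ext a
      simp only [Finset.mem_filter, Finset.mem_univ, true_and, Prod.mk.injEq]
      constructor
      · exact fun h => h.2
      · rintro ⟨rfl, rfl⟩
        exact ⟨hq.2, rfl, rfl⟩
  · intro a ha
    simp only [Finset.coe_filter, Finset.mem_univ, true_and, Set.mem_ofPred_eq] at ha
    simp [orderedEdges, ha, (hl a).symm]

instance {n d : ℕ} : Finite (TSwitch n d) :=
  Finite.of_injective (fun s => (s.r1, s.r2, s.r3, s.r4, s.r5, s.r6, s.r7, s.r8, s.r9, s.r10,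
    s.r11, s.r12)) fun s t h => by
    cases s; cases t
    simpa only [TSwitch.mk.injEq, Prod.mk.injEq] using h

lemma IsTSwitch.eq_of_odd {P : Pairing n d} {s t : TSwitch n d} (hs : IsTSwitch P s)
    (ht : IsTSwitch P t) (h1 : s.r1 = t.r1) (h3 : s.r3 = t.r3) (h5 : s.r5 = t.r5)
    (h7 : s.r7 = t.r7) (h9 : s.r9 = t.r9) (h11 : s.r11 = t.r11) : s = t := by
  obtain ⟨a1, a2, a3, a4, a5, a6, -⟩ := hs
  obtain ⟨b1, b2, b3, b4, b5, b6, -⟩ := ht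
  cases s
  cases t
  simp only at *
  subst h1 h3 h5 h7 h9 h11
  subst a1 a2 a3 a4 a5 a6 b1 b2 b3 b4 b5 b6
  rfl

lemma card_tripleLabels (P : Pairing n d) :
    Nat.card ((p : {p // p ∈ orderedEdges P 3}) × (Fin 3 ↪
      {a : Point n d // a ∈ Finset.univ.filter fun a : Point n d =>
        a.1 = p.1.1 ∧ (P.f a).1 = p.1.2})) = 12 * edgesWithMult P 3 := by
  have h6 : ∀ p : {p // p ∈ orderedEdges P 3}, Nat.card (Fin 3 ↪
      {a : Point n d // a ∈ Finset.univ.filter fun a : Point n d =>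
        a.1 = p.1.1 ∧ (P.f a).1 = p.1.2}) = 6 := by
    rintro ⟨p, hp⟩
    simp only [orderedEdges, Finset.mem_filter, Finset.mem_univ, true_and] at hp
    have h3 := hp.2
    rw [mult] at h3
    rw [Nat.card_eq_fintype_card, Fintype.card_embedding_eq, Fintype.card_coe, h3,
      Fintype.card_fin]
    decide
  rw [Nat.card_sigma]
  simp only [h6, Finset.sum_const, Finset.card_univ, Fintype.card_coe, card_orderedEdges,
    smul_eq_mul]
  ring

lemma fT_le (P : Pairing n d) : fT P ≤ 12 * edgesWithMult P 3 * (n * d) ^ 3 := by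
  have hc : 12 * edgesWithMult P 3 * (n * d) ^ 3 =
      Nat.card (((p : {p // p ∈ orderedEdges P 3}) × (Fin 3 ↪
        {a : Point n d // a ∈ Finset.univ.filter fun a : Point n d =>
          a.1 = p.1.1 ∧ (P.f a).1 = p.1.2})) × (Point n d × Point n d × Point n d)) := by
    rw [Nat.card_prod, card_tripleLabels]
    simp only [Nat.card_eq_fintype_card, Fintype.card_prod, Fintype.card_fin]
    ring
  rw [hc, fT]
  have mem1 : ∀ s : {s : TSwitch n d // IsTSwitch P s},
      (s.1.r1.1, s.1.r2.1) ∈ orderedEdges P 3 := by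
    rintro ⟨s, hs⟩
    simp only [IsTSwitch, List.pairwise_cons, List.mem_cons, forall_eq_or_imp] at hs
    simp only [orderedEdges, Finset.mem_filter, Finset.mem_univ, true_and]
    tauto
  have mem2 : ∀ s : {s : TSwitch n d // IsTSwitch P s}, ∀ k : Fin 3,
      ![s.1.r1, s.1.r3, s.1.r5] k ∈ Finset.univ.filter fun a : Point n d =>
          a.1 = s.1.r1.1 ∧ (P.f a).1 = s.1.r2.1 := by
    rintro ⟨s, hs⟩ k
    obtain ⟨h1, h2, h3, -, -, -, h4, h5, h6, h7, -⟩ := hs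
    fin_cases k <;> simp [h1, h2, h3, h4, h5, h6, h7]
  have hinj : ∀ s : {s : TSwitch n d // IsTSwitch P s},
      Function.Injective ![s.1.r1, s.1.r3, s.1.r5] := by
    rintro ⟨s, hs⟩ k l
    obtain ⟨-, -, -, -, -, -, -, -, -, -, h1, h2, h3, -⟩ := hs
    fin_cases k <;> fin_cases l <;> simp [h1, h2, h3, h1.symm, h2.symm, h3.symm]
  refine Nat.card_le_card_of_injective (fun s =>
    (⟨⟨(s.1.r1.1, s.1.r2.1), mem1 s⟩, ⟨fun k => ⟨![s.1.r1, s.1.r3, s.1.r5] k, mem2 s k⟩,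
      fun k l h => hinj s (congrArg Subtype.val h)⟩⟩, s.1.r7, s.1.r9, s.1.r11)) ?_
  intro s t h
  have hfun : ∀ k, ![s.1.r1, s.1.r3, s.1.r5] k = ![t.1.r1, t.1.r3, t.1.r5] k := fun k =>
    congrArg (fun z => ((z.1.2 k).1 : Point n d)) h
  exact Subtype.ext (s.2.eq_of_odd t.2 (hfun 0) (hfun 1) (hfun 2) (congrArg (fun z => z.2.1) h)
    (congrArg (fun z => z.2.2.1) h) (congrArg (fun z => z.2.2.2) h))

/-- Three distinct labelled points in a common bin. -/
abbrev Star (n d : ℕ) := Fin n × (Fin 3 ↪ Fin d)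

/-- The `k`-th labelled point of a star. -/
def Star.pt (s : Star n d) (k : Fin 3) : Point n d := (s.1, s.2 k)

lemma Star.ext_pt {s t : Star n d} (h : ∀ k, s.pt k = t.pt k) : s = t :=
  Prod.ext (congrArg (fun a : Point n d => a.1) (h 0))
    (DFunLike.ext _ _ fun k => congrArg (fun a : Point n d => a.2) (h k))

lemma Star.pt_injective (s : Star n d) : Function.Injective s.pt := fun _ _ h =>
  s.2.injective (congrArg Prod.snd h)

lemma card_star : Fintype.card (Star n d) = n * d.descFactorial 3 := by
  simp [Star, Fintype.card_embedding_eq]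

lemma card_pt_mem_le (A : Finset (Point n d)) (k : Fin 3) :
    (Finset.univ.filter fun t : Star n d => t.pt k ∈ A).card ≤ A.card * d ^ 2 := by
  have h : A.card * d ^ 2 = (A ×ˢ (Finset.univ : Finset (Fin d × Fin d))).card := by
    simp [Finset.card_product, sq]
  rw [h]
  refine Finset.card_le_card_of_injOn (fun t => (t.pt k, t.2 (k + 1), t.2 (k + 2))) ?_ ?_
  · intro t ht
    simpa using ht
  · intro s _ t _ hst
    simp only [Prod.mk.injEq, Star.pt] at hst
    refine Prod.ext hst.1.1 (DFunLike.ext _ _ fun l => ?_)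
    obtain ⟨⟨-, h0⟩, h1, h2⟩ := hst
    have hl : l = k ∨ l = k + 1 ∨ l = k + 2 := by
      clear * -
      decide +revert
    rcases hl with rfl | rfl | rfl <;> assumption

lemma card_right_mem_le (k : Fin 3) (N : ℕ) (A : Star n d → Finset (Point n d))
    (hA : ∀ s, (A s).card ≤ N) :
    (Finset.univ.filter fun q : Star n d × Star n d => q.2.pt k ∈ A q.1).card ≤
      Fintype.card (Star n d) * (N * d ^ 2) := by
  rw [Finset.card_eq_sum_card_fiberwise (f := Prod.fst) (t := Finset.univ) (by simp),
    ← Finset.card_univ, ← smul_eq_mul]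
  refine Finset.sum_le_card_nsmul _ _ _ fun s _ => ?_
  refine le_trans ?_ ((card_pt_mem_le (A s) k).trans (Nat.mul_le_mul_right _ (hA s)))
  refine Finset.card_le_card_of_injOn Prod.snd ?_ ?_
  · rintro ⟨a, b⟩ h
    simp only [Finset.coe_filter, Finset.mem_filter, Finset.mem_univ, true_and,
      Set.mem_ofPred_eq] at h ⊢
    obtain ⟨h, rfl⟩ := h
    exact h
  · rintro ⟨a, b⟩ h ⟨a', b'⟩ h' e
    simp only [Finset.coe_filter, Finset.mem_filter, Finset.mem_univ, true_and,
      Set.mem_ofPred_eq] at h h' e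
    rw [h.2, h'.2, e]

lemma card_left_mem_le (k : Fin 3) (N : ℕ) (A : Finset (Point n d)) (hA : A.card ≤ N) :
    (Finset.univ.filter fun q : Star n d × Star n d => q.1.pt k ∈ A).card ≤
      Fintype.card (Star n d) * (N * d ^ 2) := by
  refine le_trans ?_ (card_right_mem_le k N (fun _ => A) fun _ => hA)
  refine Finset.card_le_card_of_injOn Prod.swap ?_ Prod.swap_injective.injOn
  intro q hq
  simpa using hq

lemma card_filter_f (P : Pairing n d) (p : Point n d → Prop) [DecidablePred p] :
    (Finset.univ.filter fun a => p (P.f a)).card = (Finset.univ.filter p).card := by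
  refine Finset.card_bij' (fun a _ => P.f a) (fun a _ => P.f a) ?_ ?_ ?_ ?_ <;>
    simp +contextual [P.invol]

lemma card_bin (x : Fin n) :
    (Finset.univ.filter fun a : Point n d => a.1 = x).card = d := by
  have h : (Finset.univ.filter fun a : Point n d => a.1 = x) =
      ({x} : Finset (Fin n)) ×ˢ (Finset.univ : Finset (Fin d)) := by
    ext ⟨y, e⟩
    simp [eq_comm]
  simp [h]

lemma card_neighbourPoints_le (P : Pairing n d) (x : Fin n) :
    (Finset.univ.filter fun a : Point n d => mult P x a.1 ≠ 0).card ≤ d ^ 2 := by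
  have h : d ^ 2 = (Finset.univ : Finset (Fin d × Fin d)).card := by simp [sq]
  rw [h]
  refine le_trans (Finset.card_le_card ?_) (Finset.card_image_le
    (f := fun e : Fin d × Fin d => (((P.f (x, e.1)).1, e.2) : Point n d)))
  rintro ⟨y, e⟩ ha
  simp only [Finset.mem_filter, Finset.mem_univ, true_and] at ha
  obtain ⟨⟨z, c⟩, hz⟩ := Finset.card_pos.1 (Nat.pos_of_ne_zero ha)
  simp only [Finset.mem_filter, Finset.mem_univ, true_and] at hz
  obtain ⟨rfl, rfl⟩ := hz
  exact Finset.mem_image.2 ⟨(c, e), Finset.mem_univ _, rfl⟩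

/-- The pairs of stars at which a type T switching resulting in `P` can be undone, creating
a triple edge between the bins of the two stars. -/
structure Reversible (P : Pairing n d) (s t : Star n d) : Prop where
  left : ∀ k, mult P (s.pt k).1 (P.f (s.pt k)).1 = 1
  right : ∀ k, mult P (t.pt k).1 (P.f (t.pt k)).1 = 1
  centre_ne : s.1 ≠ t.1
  centre_mult : mult P s.1 t.1 = 0
  leaf_ne : ∀ k l, (P.f (s.pt k)).1 ≠ (P.f (t.pt l)).1
  leaf_mult : ∀ k, mult P (P.f (s.pt k)).1 (P.f (t.pt k)).1 = 0

lemma card_nonsingle_le (P : Pairing n d) (hl : ∀ a, (P.f a).1 ≠ a.1)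
    (hm : ∀ u v : Fin n, u ≠ v → mult P u v ≤ 3) :
    (Finset.univ.filter fun a : Point n d => mult P a.1 (P.f a).1 ≠ 1).card ≤
      4 * edgesWithMult P 2 + 6 * edgesWithMult P 3 := by
  have h2 := card_points_of_mult P hl 2
  have h3 := card_points_of_mult P hl 3
  norm_num at h2 h3
  rw [← h2, ← h3]
  refine le_trans (Finset.card_le_card ?_) (Finset.card_union_le _ _)
  intro a ha
  have h1 := mult_f_pos P a
  have h4 := hm _ _ (hl a).symm
  simp only [Finset.mem_filter, Finset.mem_univ, true_and, Finset.mem_union] at ha ⊢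
  omega

open Classical in
lemma card_star_sq_le (P : Pairing n d) (hl : ∀ a, (P.f a).1 ≠ a.1)
    (hm : ∀ u v : Fin n, u ≠ v → mult P u v ≤ 3) :
    Fintype.card (Star n d) ^ 2 ≤
      (Finset.univ.filter fun q : Star n d × Star n d => Reversible P q.1 q.2).card +
      Fintype.card (Star n d) * (d ^ 2 *
        (6 * (4 * edgesWithMult P 2 + 6 * edgesWithMult P 3) + 10 * d + 4 * d ^ 2)) := by
  set T := Fintype.card (Star n d) with hT
  set N := 4 * edgesWithMult P 2 + 6 * edgesWithMult P 3 with hN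
  let B : Finset (Point n d) := Finset.univ.filter fun a => mult P a.1 (P.f a).1 ≠ 1
  have hB : B.card ≤ N := card_nonsingle_le P hl hm
  let B1 := Finset.univ.biUnion fun k : Fin 3 =>
    Finset.univ.filter fun q : Star n d × Star n d => q.1.pt k ∈ B
  let B2 := Finset.univ.biUnion fun k : Fin 3 =>
    Finset.univ.filter fun q : Star n d × Star n d => q.2.pt k ∈ B
  let B3 := Finset.univ.filter fun q : Star n d × Star n d =>
    q.2.pt 0 ∈ Finset.univ.filter fun a : Point n d => a.1 = q.1.1
  let B4 := Finset.univ.filter fun q : Star n d × Star n d =>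
    q.2.pt 0 ∈ Finset.univ.filter fun a : Point n d => mult P q.1.1 a.1 ≠ 0
  let B5 := Finset.univ.biUnion fun kl : Fin 3 × Fin 3 =>
    Finset.univ.filter fun q : Star n d × Star n d =>
      q.2.pt kl.2 ∈ Finset.univ.filter fun a : Point n d => (P.f a).1 = (P.f (q.1.pt kl.1)).1
  let B6 := Finset.univ.biUnion fun k : Fin 3 =>
    Finset.univ.filter fun q : Star n d × Star n d =>
      q.2.pt k ∈ Finset.univ.filter fun a : Point n d =>
        mult P (P.f (q.1.pt k)).1 (P.f a).1 ≠ 0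
  have c1 : B1.card ≤ 3 * (T * (N * d ^ 2)) :=
    Finset.card_biUnion_le_card_mul _ _ _ fun k _ => card_left_mem_le k N B hB
  have c2 : B2.card ≤ 3 * (T * (N * d ^ 2)) :=
    Finset.card_biUnion_le_card_mul _ _ _ fun k _ => card_right_mem_le k N (fun _ => B) fun _ => hB
  have c3 : B3.card ≤ T * (d * d ^ 2) :=
    card_right_mem_le 0 d (fun s => Finset.univ.filter fun a : Point n d => a.1 = s.1)
      fun s => (card_bin s.1).le
  have c4 : B4.card ≤ T * (d ^ 2 * d ^ 2) :=
    card_right_mem_le 0 (d ^ 2)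
      (fun s => Finset.univ.filter fun a : Point n d => mult P s.1 a.1 ≠ 0)
      fun s => card_neighbourPoints_le P s.1
  have c5 : B5.card ≤ 9 * (T * (d * d ^ 2)) :=
    Finset.card_biUnion_le_card_mul _ _ _ fun kl _ => card_right_mem_le kl.2 d
      (fun s => Finset.univ.filter fun a : Point n d => (P.f a).1 = (P.f (s.pt kl.1)).1)
      fun s => ((card_filter_f P fun a => a.1 = (P.f (s.pt kl.1)).1).trans (card_bin _)).le
  have c6 : B6.card ≤ 3 * (T * (d ^ 2 * d ^ 2)) :=
    Finset.card_biUnion_le_card_mul _ _ _ fun k _ => card_right_mem_le k (d ^ 2)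
      (fun s => Finset.univ.filter fun a : Point n d => mult P (P.f (s.pt k)).1 (P.f a).1 ≠ 0)
      fun s => (card_filter_f P fun a => mult P (P.f (s.pt k)).1 a.1 ≠ 0).le.trans
        (card_neighbourPoints_le P _)
  have hcov : (Finset.univ : Finset (Star n d × Star n d)) ⊆
      (Finset.univ.filter fun q : Star n d × Star n d => Reversible P q.1 q.2) ∪
        (B1 ∪ (B2 ∪ (B3 ∪ (B4 ∪ (B5 ∪ B6))))) := by
    rintro ⟨s, t⟩ -
    by_contra hq
    simp only [B1, B2, B3, B4, B5, B6, B, Finset.mem_union, Finset.mem_filter, Finset.mem_univ,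
      true_and, Finset.mem_biUnion, not_or, not_exists, not_not, Prod.forall] at hq
    obtain ⟨h0, h1, h2, h3, h4, h5, h6⟩ := hq
    exact h0 ⟨h1, h2, Ne.symm h3, h4, fun k l h => h5 k l h.symm, h6⟩
  have hcard := Finset.card_le_card hcov
  rw [Finset.card_univ, Fintype.card_prod, ← hT] at hcard
  have u1 := Finset.card_union_le
    (Finset.univ.filter fun q : Star n d × Star n d => Reversible P q.1 q.2)
    (B1 ∪ (B2 ∪ (B3 ∪ (B4 ∪ (B5 ∪ B6)))))
  have u2 := Finset.card_union_le B1 (B2 ∪ (B3 ∪ (B4 ∪ (B5 ∪ B6))))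
  have u3 := Finset.card_union_le B2 (B3 ∪ (B4 ∪ (B5 ∪ B6)))
  have u4 := Finset.card_union_le B3 (B4 ∪ (B5 ∪ B6))
  have u5 := Finset.card_union_le B4 (B5 ∪ B6)
  have u6 := Finset.card_union_le B5 B6
  have e : T * (d ^ 2 * (6 * N + 10 * d + 4 * d ^ 2)) =
      3 * (T * (N * d ^ 2)) + 3 * (T * (N * d ^ 2)) + T * (d * d ^ 2) + T * (d ^ 2 * d ^ 2) +
        9 * (T * (d * d ^ 2)) + 3 * (T * (d ^ 2 * d ^ 2)) := by ring
  rw [e, sq]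
  omega

lemma conj_swap_f_right (P : Pairing n d) {a b : Point n d} (h : P.f a ≠ b) :
    (conj P (Equiv.swap a b)).f b = P.f a := by
  simp [conj, Equiv.swap_apply_of_ne_of_ne, h, P.nofix a]

lemma conj_swap_f_f_right (P : Pairing n d) {a b : Point n d} (h : P.f a ≠ b) :
    (conj P (Equiv.swap a b)).f (P.f b) = a := by
  have h' : P.f b ≠ a := fun e => h (by rw [← e, P.invol])
  simp [conj, Equiv.swap_apply_of_ne_of_ne, P.invol, h', P.nofix b]

/-- The effect of simultaneously replacing the pairs `{a k, f (a k)}`, `{b k, f (b k)}` by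
`{a k, b k}`, `{f (a k), f (b k)}`, `k = 0, 1, 2`. -/
lemma conj_three_swaps (P : Pairing n d) (a b : Fin 3 → Point n d)
    (hab : ∀ k l, a k ≠ b l) (hfa : ∀ k l, P.f (a k) ≠ a l) (hfb : ∀ k l, P.f (b k) ≠ b l)
    (hfab : ∀ k l, P.f (a k) ≠ b l) (ha : Function.Injective a) (hb : Function.Injective b) :
    let Q := conj (conj (conj P (Equiv.swap (b 2) (P.f (a 2)))) (Equiv.swap (b 1) (P.f (a 1))))
      (Equiv.swap (b 0) (P.f (a 0)))
    (∀ k, Q.f (a k) = b k ∧ Q.f (P.f (a k)) = P.f (b k)) ∧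
    ∀ x y, mult Q x y + ∑ k, (joinInd x y (a k).1 (P.f (a k)).1 +
        joinInd x y (b k).1 (P.f (b k)).1) =
      mult P x y + ∑ k, (joinInd x y (a k).1 (b k).1 +
        joinInd x y (P.f (a k)).1 (P.f (b k)).1) := by
  have hinj : ∀ x y, P.f x = P.f y ↔ x = y := fun x y =>
    ⟨fun h => by rw [← P.invol x, h, P.invol], fun h => h ▸ rfl⟩
  have hba : ∀ k l, b k ≠ a l := fun k l => (hab l k).symm
  have hfa' : ∀ k l, a k ≠ P.f (a l) := fun k l => (hfa l k).symm
  have hfb' : ∀ k l, b k ≠ P.f (b l) := fun k l => (hfb l k).symm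
  have hfab' : ∀ k l, b k ≠ P.f (a l) := fun k l => (hfab l k).symm
  have hfba : ∀ k l, P.f (b k) ≠ a l := fun k l h => hfab l k (by rw [← h, P.invol])
  have hfba' : ∀ k l, a k ≠ P.f (b l) := fun k l => (hfba l k).symm
  intro Q
  have keep : ∀ (R : Pairing n d) (k : Fin 3), R.f (a k) = P.f (a k) → R.f (b k) = P.f (b k) →
      ∀ z, z ≠ a k → z ≠ b k → z ≠ P.f (a k) → z ≠ P.f (b k) →
      (conj R (Equiv.swap (b k) (P.f (a k)))).f z = R.f z := by
    intro R k h1 h2 z z1 z2 z3 z4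
    refine conj_swap_f_of_ne R z2 z3 (by rwa [h2]) ?_
    rw [← h1, R.invol]
    exact z1
  have step : ∀ (R : Pairing n d) (k : Fin 3), R.f (a k) = P.f (a k) → R.f (b k) = P.f (b k) →
      let S := conj R (Equiv.swap (b k) (P.f (a k)))
      S.f (a k) = b k ∧ S.f (P.f (a k)) = P.f (b k) ∧
      ∀ x y, mult S x y + (joinInd x y (a k).1 (P.f (a k)).1 +
          joinInd x y (b k).1 (P.f (b k)).1) =
        mult R x y + (joinInd x y (a k).1 (b k).1 +
          joinInd x y (P.f (a k)).1 (P.f (b k)).1) := by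
    intro R k h1 h2 S
    have h3 : R.f (P.f (a k)) = a k := by rw [← h1, R.invol]
    have h4 : R.f (b k) ≠ P.f (a k) := by
      rw [h2]
      exact fun h => hba k k ((hinj _ _).1 h)
    refine ⟨?_, ?_, fun x y => ?_⟩
    · have := conj_swap_f_f_right R h4
      rwa [h3] at this
    · rw [← h2]
      exact conj_swap_f_right R h4
    · have := mult_conj_swap R (hfab' k k) h4 x y
      rw [h3, h2] at this
      have comm : ∀ p q, joinInd x y p q = joinInd x y q p := fun p q => by
        simp only [joinInd, add_comm]
      rw [comm (P.f (a k)).1 (a k).1, comm (b k).1 (a k).1] at this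
      simp only [S]
      omega
  have keepA : ∀ (R : Pairing n d) (k l : Fin 3), l ≠ k → R.f (a k) = P.f (a k) →
      R.f (b k) = P.f (b k) →
      let S := conj R (Equiv.swap (b k) (P.f (a k)))
      S.f (a l) = R.f (a l) ∧ S.f (b l) = R.f (b l) ∧ S.f (P.f (a l)) = R.f (P.f (a l)) := by
    intro R k l hkl h1 h2 S
    exact ⟨keep R k h1 h2 _ (ha.ne hkl) (hab _ _) (hfa' _ _) (hfba' _ _),
      keep R k h1 h2 _ (hba _ _) (hb.ne hkl) (hfab' _ _) (hfb' _ _),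
      keep R k h1 h2 _ (hfa _ _) (hfab _ _) (fun h => ha.ne hkl ((hinj _ _).1 h))
        fun h => hab _ _ ((hinj _ _).1 h)⟩
  have s2 := step P 2 rfl rfl
  have k20 := keepA P 2 0 (by decide) rfl rfl
  have k21 := keepA P 2 1 (by decide) rfl rfl
  have s1 := step _ 1 k21.1 k21.2.1
  have k10 := keepA _ 1 0 (by decide) k21.1 k21.2.1
  have k12 := keepA _ 1 2 (by decide) k21.1 k21.2.1
  have s0 := step _ 0 (k10.1.trans k20.1) (k10.2.1.trans k20.2.1)
  have k01 := keepA _ 0 1 (by decide) (k10.1.trans k20.1) (k10.2.1.trans k20.2.1)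
  have k02 := keepA _ 0 2 (by decide) (k10.1.trans k20.1) (k10.2.1.trans k20.2.1)
  refine ⟨fun k => ?_, fun x y => ?_⟩
  · fin_cases k
    · exact ⟨s0.1, s0.2.1⟩
    · exact ⟨k01.1.trans s1.1, k01.2.2.trans s1.2.1⟩
    · exact ⟨(k02.1.trans k12.1).trans s2.1, (k02.2.2.trans k12.2.2).trans s2.2.1⟩
  · have m0 := s0.2.2 x y
    have m1 := s1.2.2 x y
    have m2 := s2.2.2 x y
    simp only [Fin.sum_univ_three, Q]
    omega

/-- The type T switching producing `P` that is determined by two stars. -/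
def revSwitch (P : Pairing n d) (s t : Star n d) : TSwitch n d :=
  ⟨s.pt 0, t.pt 0, s.pt 1, t.pt 1, s.pt 2, t.pt 2,
    P.f (s.pt 0), P.f (t.pt 0), P.f (s.pt 1), P.f (t.pt 1), P.f (s.pt 2), P.f (t.pt 2)⟩

/-- The pairing on which `revSwitch P s t` is to be performed to produce `P`. -/
def revPairing (P : Pairing n d) (s t : Star n d) : Pairing n d :=
  conj P (ttau (revSwitch P s t)).symm

lemma tResult_revPairing (P : Pairing n d) (s t : Star n d) :
    tResult (revPairing P s t) (revSwitch P s t) = P :=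
  conj_symm_conj P _

lemma Star.leaf_injective {P : Pairing n d} {s : Star n d}
    (h : ∀ k, mult P (s.pt k).1 (P.f (s.pt k)).1 = 1) :
    Function.Injective fun k => (P.f (s.pt k)).1 := by
  intro k l hkl
  obtain ⟨c, hc⟩ := Finset.card_eq_one.1 (h k)
  have h1 : s.pt k ∈ ({c} : Finset (Point n d)) := by
    rw [← hc]
    simp
  have h2 : s.pt l ∈ ({c} : Finset (Point n d)) := by
    rw [← hc]
    simp only [Finset.mem_filter, Finset.mem_univ, true_and]
    exact ⟨rfl, hkl.symm⟩
  rw [Finset.mem_singleton] at h1 h2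
  exact s.pt_injective (h1.trans h2.symm)

lemma Reversible.left_leaf_ne {P : Pairing n d} {s t : Star n d} (h : Reversible P s t)
    (k : Fin 3) : (P.f (s.pt k)).1 ≠ t.1 := by
  intro e
  have h1 := h.left k
  rw [e] at h1
  exact absurd (h1.symm.trans h.centre_mult) one_ne_zero

lemma Reversible.symm {P : Pairing n d} {s t : Star n d} (h : Reversible P s t) :
    Reversible P t s where
  left := h.right
  right := h.left
  centre_ne := h.centre_ne.symm
  centre_mult := by rw [mult_comm, h.centre_mult]
  leaf_ne k l := (h.leaf_ne l k).symm
  leaf_mult k := by rw [mult_comm, h.leaf_mult]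

lemma joinInd_eq_zero {x y p q : Fin n} (h1 : ¬(x = p ∧ y = q)) (h2 : ¬(x = q ∧ y = p)) :
    joinInd x y p q = 0 := by
  simp only [joinInd]
  rw [if_neg (fun h => h1 ⟨h.1.symm, h.2.symm⟩), if_neg (fun h => h2 ⟨h.1.symm, h.2.symm⟩)]

lemma Reversible.revPairing_spec {P : Pairing n d} {s t : Star n d} (h : Reversible P s t)
    (hl : ∀ a, (P.f a).1 ≠ a.1) :
    (∀ k, (revPairing P s t).f (s.pt k) = t.pt k ∧
      (revPairing P s t).f (P.f (s.pt k)) = P.f (t.pt k)) ∧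
    ∀ x y, mult (revPairing P s t) x y + ∑ k, (joinInd x y s.1 (P.f (s.pt k)).1 +
        joinInd x y t.1 (P.f (t.pt k)).1) =
      mult P x y + ∑ k, (joinInd x y s.1 t.1 +
        joinInd x y (P.f (s.pt k)).1 (P.f (t.pt k)).1) :=
  conj_three_swaps P s.pt t.pt (fun _ _ e => h.centre_ne (congrArg (fun a : Point n d => a.1) e))
    (fun k l e => hl (s.pt k) (show (P.f (s.pt k)).1 = (s.pt l).1 by rw [e]))
    (fun k l e => hl (t.pt k) (show (P.f (t.pt k)).1 = (t.pt l).1 by rw [e]))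
    (fun k _ e => h.left_leaf_ne k (congrArg (fun a : Point n d => a.1) e))
    s.pt_injective t.pt_injective

section Multiplicities

variable {P : Pairing n d} {s t : Star n d}

lemma Reversible.mult_revPairing_centres (h : Reversible P s t) (hl : ∀ a, (P.f a).1 ≠ a.1) :
    mult (revPairing P s t) s.1 t.1 = 3 := by
  have e := (h.revPairing_spec hl).2 s.1 t.1
  have n1 := h.centre_ne
  have n2 := h.left_leaf_ne
  have n3 := h.symm.left_leaf_ne
  have n4 : ∀ k, (P.f (s.pt k)).1 ≠ s.1 := fun k => hl (s.pt k)
  simpa [joinInd, h.centre_mult, n1, n1.symm, n2, n3, n4, (n2 _).symm, (n3 _).symm] using e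

lemma Reversible.mult_revPairing_left (h : Reversible P s t) (hl : ∀ a, (P.f a).1 ≠ a.1)
    (k : Fin 3) : mult (revPairing P s t) s.1 (P.f (s.pt k)).1 = 0 := by
  have e := (h.revPairing_spec hl).2 s.1 (P.f (s.pt k)).1
  have n1 := h.centre_ne
  have n2 := h.left_leaf_ne
  have n3 := h.symm.left_leaf_ne
  have n4 : ∀ k, (P.f (s.pt k)).1 ≠ s.1 := fun k => hl (s.pt k)
  have n5 : ∀ k l, (P.f (s.pt k)).1 = (P.f (s.pt l)).1 ↔ k = l := fun k l =>
    (Star.leaf_injective h.left).eq_iff (a := k) (b := l)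
  have n6 : mult P s.1 (P.f (s.pt k)).1 = 1 := h.left k
  simpa [joinInd, n6, n1, n1.symm, n2, n3, n4, n5, (n2 _).symm, (n3 _).symm, (n4 _).symm] using e

lemma Reversible.mult_revPairing_right (h : Reversible P s t) (hl : ∀ a, (P.f a).1 ≠ a.1)
    (k : Fin 3) : mult (revPairing P s t) t.1 (P.f (t.pt k)).1 = 0 := by
  have e := (h.revPairing_spec hl).2 t.1 (P.f (t.pt k)).1
  have n1 := h.centre_ne
  have n2 := h.left_leaf_ne
  have n3 := h.symm.left_leaf_ne
  have n4 : ∀ k, (P.f (t.pt k)).1 ≠ t.1 := fun k => hl (t.pt k)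
  have n5 : ∀ k l, (P.f (t.pt k)).1 = (P.f (t.pt l)).1 ↔ k = l := fun k l =>
    (Star.leaf_injective h.right).eq_iff (a := k) (b := l)
  have n6 : mult P t.1 (P.f (t.pt k)).1 = 1 := h.right k
  simpa [joinInd, n6, n1, n1.symm, n2, n3, n4, n5, (n2 _).symm, (n3 _).symm, (n4 _).symm] using e

lemma Reversible.mult_revPairing_leaves (h : Reversible P s t) (hl : ∀ a, (P.f a).1 ≠ a.1)
    (k : Fin 3) : mult (revPairing P s t) (P.f (s.pt k)).1 (P.f (t.pt k)).1 = 1 := by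
  have e := (h.revPairing_spec hl).2 (P.f (s.pt k)).1 (P.f (t.pt k)).1
  have n1 := h.centre_ne
  have n2 := h.left_leaf_ne
  have n3 := h.symm.left_leaf_ne
  have n4 : ∀ k, (P.f (t.pt k)).1 ≠ t.1 := fun k => hl (t.pt k)
  have n4' : ∀ k, (P.f (s.pt k)).1 ≠ s.1 := fun k => hl (s.pt k)
  have n5 : ∀ k l, (P.f (t.pt k)).1 = (P.f (t.pt l)).1 ↔ k = l := fun k l =>
    (Star.leaf_injective h.right).eq_iff (a := k) (b := l)
  have n6 : ∀ k l, (P.f (s.pt k)).1 = (P.f (s.pt l)).1 ↔ k = l := fun k l =>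
    (Star.leaf_injective h.left).eq_iff (a := k) (b := l)
  have n7 := h.leaf_ne
  simpa [joinInd, h.leaf_mult, n1, n1.symm, n2, n3, n4, n4', n5, n6, n7, (n2 _).symm,
    (n3 _).symm, (n4 _).symm, (n4' _).symm, (n7 _ _).symm] using e

lemma Reversible.mult_revPairing (h : Reversible P s t) (hl : ∀ a, (P.f a).1 ≠ a.1)
    (x y : Fin n) :
    ((x = s.1 ∧ y = t.1) ∨ (x = t.1 ∧ y = s.1)) ∨
    mult (revPairing P s t) x y = mult P x y ∨
    (mult (revPairing P s t) x y ≤ 1 ∧ mult P x y ≤ 1) := by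
  by_cases h0 : (x = s.1 ∧ y = t.1) ∨ (x = t.1 ∧ y = s.1)
  · exact Or.inl h0
  refine Or.inr ?_
  by_cases h1 : ∃ k, (x = s.1 ∧ y = (P.f (s.pt k)).1) ∨ (x = (P.f (s.pt k)).1 ∧ y = s.1)
  · right
    have a := h.mult_revPairing_left hl
    have b : ∀ k, mult P s.1 (P.f (s.pt k)).1 = 1 := h.left
    obtain ⟨k, ⟨rfl, rfl⟩ | ⟨rfl, rfl⟩⟩ := h1
    · simp [a, b]
    · simp [mult_comm _ _ s.1, a, b]
  by_cases h2 : ∃ k, (x = t.1 ∧ y = (P.f (t.pt k)).1) ∨ (x = (P.f (t.pt k)).1 ∧ y = t.1)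
  · right
    have a := h.mult_revPairing_right hl
    have b : ∀ k, mult P t.1 (P.f (t.pt k)).1 = 1 := h.right
    obtain ⟨k, ⟨rfl, rfl⟩ | ⟨rfl, rfl⟩⟩ := h2
    · simp [a, b]
    · simp [mult_comm _ _ t.1, a, b]
  by_cases h3 : ∃ k, (x = (P.f (s.pt k)).1 ∧ y = (P.f (t.pt k)).1) ∨
      (x = (P.f (t.pt k)).1 ∧ y = (P.f (s.pt k)).1)
  · right
    have a := h.mult_revPairing_leaves hl
    have b := h.leaf_mult
    obtain ⟨k, ⟨rfl, rfl⟩ | ⟨rfl, rfl⟩⟩ := h3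
    · simp [a, b]
    · simp [mult_comm _ _ (P.f (s.pt k)).1, a, b]
  left
  have e := (h.revPairing_spec hl).2 x y
  push Not at h0 h1 h2 h3
  have z0 : joinInd x y s.1 t.1 = 0 := joinInd_eq_zero (by tauto) (by tauto)
  have z1 : ∀ k, joinInd x y s.1 (P.f (s.pt k)).1 = 0 := fun k =>
    joinInd_eq_zero (fun c => (h1 k).1 c.1 c.2) (fun c => (h1 k).2 c.1 c.2)
  have z2 : ∀ k, joinInd x y t.1 (P.f (t.pt k)).1 = 0 := fun k =>
    joinInd_eq_zero (fun c => (h2 k).1 c.1 c.2) (fun c => (h2 k).2 c.1 c.2)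
  have z3 : ∀ k, joinInd x y (P.f (s.pt k)).1 (P.f (t.pt k)).1 = 0 := fun k =>
    joinInd_eq_zero (fun c => (h3 k).1 c.1 c.2) (fun c => (h3 k).2 c.1 c.2)
  simpa [z0, z1, z2, z3] using e

lemma Reversible.revPairing_f_ne (h : Reversible P s t) (hl : ∀ a, (P.f a).1 ≠ a.1)
    (a : Point n d) : ((revPairing P s t).f a).1 ≠ a.1 := by
  intro ha
  have h1 := mult_f_pos (revPairing P s t) a
  rw [ha] at h1
  have h2 : mult P a.1 a.1 = 0 := by
    simp only [mult, Finset.card_eq_zero, Finset.filter_eq_empty_iff]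
    exact fun b _ hb => hl b (hb.2.trans hb.1.symm)
  have e := (h.revPairing_spec hl).2 a.1 a.1
  have j0 : ∀ p q : Fin n, p ≠ q → joinInd a.1 a.1 p q = 0 := fun p q hpq =>
    joinInd_eq_zero (fun c => hpq (c.1.symm.trans c.2)) (fun c => hpq (c.2.symm.trans c.1))
  simp only [h2, j0 _ _ h.centre_ne, j0 _ _ (h.leaf_ne _ _), Finset.sum_const_zero, add_zero] at e
  omega

lemma Reversible.edgesWithMult_three (h : Reversible P s t) (hl : ∀ a, (P.f a).1 ≠ a.1) :
    edgesWithMult (revPairing P s t) 3 = edgesWithMult P 3 + 1 := by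
  have e : orderedEdges (revPairing P s t) 3 =
      insert (s.1, t.1) (insert (t.1, s.1) (orderedEdges P 3)) := by
    ext ⟨x, y⟩
    simp only [orderedEdges, Finset.mem_filter, Finset.mem_univ, true_and, Finset.mem_insert,
      Prod.mk.injEq]
    rcases h.mult_revPairing hl x y with (⟨rfl, rfl⟩ | ⟨rfl, rfl⟩) | h1 | h1
    · simp [h.mult_revPairing_centres hl, h.centre_ne]
    · simp [mult_comm _ t.1, h.mult_revPairing_centres hl, h.centre_ne.symm]
    · rw [h1]
      constructor
      · exact fun h => Or.inr (Or.inr h)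
      · rintro (⟨rfl, rfl⟩ | ⟨rfl, rfl⟩ | h2)
        · exact ⟨h.centre_ne, h1 ▸ h.mult_revPairing_centres hl⟩
        · rw [mult_comm, h.mult_revPairing_centres hl, mult_comm, h.centre_mult] at h1
          exact absurd h1 (by decide)
        · exact h2
    · constructor
      · exact fun h2 => by omega
      · rintro (⟨rfl, rfl⟩ | ⟨rfl, rfl⟩ | h2)
        · exact ⟨h.centre_ne, h.mult_revPairing_centres hl⟩
        · exact ⟨h.centre_ne.symm, by rw [mult_comm, h.mult_revPairing_centres hl]⟩
        · omega
  have c := card_orderedEdges (revPairing P s t) 3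
  rw [e, Finset.card_insert_of_notMem, Finset.card_insert_of_notMem, card_orderedEdges] at c
  · omega
  · simp [orderedEdges, mult_comm _ t.1, h.centre_mult]
  · simp [orderedEdges, h.centre_mult, h.centre_ne]

lemma Reversible.edgesWithMult_two (h : Reversible P s t) (hl : ∀ a, (P.f a).1 ≠ a.1) :
    edgesWithMult (revPairing P s t) 2 = edgesWithMult P 2 := by
  unfold edgesWithMult
  congr 1
  ext ⟨x, y⟩
  simp only [Finset.mem_filter, Finset.mem_univ, true_and]
  rcases h.mult_revPairing hl x y with (⟨rfl, rfl⟩ | ⟨rfl, rfl⟩) | h1 | h1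
  · simp [h.mult_revPairing_centres hl, h.centre_mult]
  · simp [mult_comm _ t.1, h.mult_revPairing_centres hl, h.centre_mult]
  · rw [h1]
  · omega

lemma Reversible.revPairing_mem_ST (h : Reversible P s t) {γ : ℝ} {i : ℕ} (hP : P ∈ ST n d γ i) :
    revPairing P s t ∈ ST n d γ (i + 1) := by
  obtain ⟨h0, h3, h2, hm⟩ := hP
  have hl := f_bin_ne_of_numLoops P h0
  refine ⟨numLoops_eq_zero _ (h.revPairing_f_ne hl), ?_, ?_, fun x y hxy => ?_⟩
  · rw [h.edgesWithMult_three hl, h3]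
  · rwa [h.edgesWithMult_two hl]
  · have := hm x y hxy
    rcases h.mult_revPairing hl x y with (⟨rfl, rfl⟩ | ⟨rfl, rfl⟩) | h1 | h1
    · exact (h.mult_revPairing_centres hl).le
    · rw [mult_comm]
      exact (h.mult_revPairing_centres hl).le
    · omega
    · omega

lemma Reversible.isTSwitch (h : Reversible P s t) (hl : ∀ a, (P.f a).1 ≠ a.1) :
    IsTSwitch (revPairing P s t) (revSwitch P s t) := by
  have hf := (h.revPairing_spec hl).1
  have n1 := h.centre_ne
  have n2 := h.left_leaf_ne
  have n3 := h.symm.left_leaf_ne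
  have n4 : ∀ k, (P.f (t.pt k)).1 ≠ t.1 := fun k => hl (t.pt k)
  have n4' : ∀ k, (P.f (s.pt k)).1 ≠ s.1 := fun k => hl (s.pt k)
  have n5 : ∀ k l, (P.f (t.pt k)).1 = (P.f (t.pt l)).1 ↔ k = l := fun k l =>
    (Star.leaf_injective h.right).eq_iff (a := k) (b := l)
  have n6 : ∀ k l, (P.f (s.pt k)).1 = (P.f (s.pt l)).1 ↔ k = l := fun k l =>
    (Star.leaf_injective h.left).eq_iff (a := k) (b := l)
  have n7 := h.leaf_ne
  refine ⟨(hf 0).1, (hf 1).1, (hf 2).1, (hf 0).2, (hf 1).2, (hf 2).2, rfl, rfl, rfl, rfl,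
    s.pt_injective.ne (by decide), s.pt_injective.ne (by decide), s.pt_injective.ne (by decide),
    h.mult_revPairing_centres hl, h.mult_revPairing_leaves hl 0, h.mult_revPairing_leaves hl 1,
    h.mult_revPairing_leaves hl 2, ?_, h.mult_revPairing_left hl 0, h.mult_revPairing_left hl 1,
    h.mult_revPairing_left hl 2, h.mult_revPairing_right hl 0, h.mult_revPairing_right hl 1,
    h.mult_revPairing_right hl 2⟩
  have f1 : ∀ k, (s.pt k).1 = s.1 := fun _ => rfl
  have f2 : ∀ k, (t.pt k).1 = t.1 := fun _ => rfl
  simp [revSwitch, f1, f2, n1, n5, n6, n7, (n2 _).symm, (n3 _).symm, (n4 _).symm, (n4' _).symm,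
    (n7 _ _).symm]

end Multiplicities

open Classical in
lemma card_reversible_le_bAT {P : Pairing n d} {γ : ℝ} {i : ℕ} (hP : P ∈ ST n d γ i)
    (hi : i + 1 ≤ BT n d) :
    (Finset.univ.filter fun q : Star n d × Star n d => Reversible P q.1 q.2).card ≤ bAT γ P := by
  have hl := f_bin_ne_of_numLoops P hP.1
  rw [← Fintype.card_subtype, ← Nat.card_eq_fintype_card, bAT]
  refine Nat.card_le_card_of_injective (fun q => ⟨(revPairing P q.1.1 q.1.2,
    revSwitch P q.1.1 q.1.2), ⟨i + 1, hi, q.2.revPairing_mem_ST hP⟩, q.2.isTSwitch hl,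
      tResult_revPairing P _ _⟩) ?_
  rintro ⟨⟨s, t⟩, _⟩ ⟨⟨s', t'⟩, _⟩ e
  have e' : revSwitch P s t = revSwitch P s' t' := congrArg (fun z => z.1.2) e
  simp only [revSwitch, TSwitch.mk.injEq] at e'
  obtain ⟨e1, e2, e3, e4, e5, e6, -⟩ := e'
  have hs : s = s' := Star.ext_pt fun k => by fin_cases k <;> assumption
  have ht : t = t' := Star.ext_pt fun k => by fin_cases k <;> assumption
  subst hs ht
  rfl

lemma card_star_eq_M3R : ((Fintype.card (Star n d) : ℕ) : ℝ) = M3R n d := by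
  rw [card_star, M3R]
  rcases d with _ | _ | d
  · simp
  · simp
  · simp [Nat.descFactorial_succ]
    ring

/-- Bounds on the type T switchings of the triple-edge reduction phase: for
`P ∈ S^T_i`, (i) `f_T(P) ≤ 12 i M1³`, and (ii) if `0 ≤ i ≤ B_T - 1` then
`b_A^T(P) ≥ M3² - 4 M3 d² (6 B_D + 9 i + 4 d + d²)`. -/
theorem stmt_11 (n d : ℕ) (hn : 0 < n) (hd : 0 < d) (he : Even (d * n))
    (γ : ℝ) (hγ : 0 < γ) (i : ℕ) (P : Pairing n d) (hP : P ∈ ST n d γ i) :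
    (fT P : ℝ) ≤ 12 * i * M1R n d ^ 3 ∧
    (i + 1 ≤ BT n d →
      M3R n d ^ 2 -
          4 * M3R n d * (d : ℝ) ^ 2 *
            (6 * (BD d γ : ℝ) + 9 * i + 4 * d + (d : ℝ) ^ 2)
        ≤ (bAT γ P : ℝ)) := by
  refine ⟨?_, fun hi => ?_⟩
  · have h : (fT P : ℝ) ≤ ((12 * edgesWithMult P 3 * (n * d) ^ 3 : ℕ) : ℝ) := by
      exact_mod_cast fT_le P
    rw [hP.2.1] at h
    push_cast at h
    rwa [M1R, mul_comm (d : ℝ)]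
  · classical
    have h1 := card_star_sq_le P (f_bin_ne_of_numLoops P hP.1) hP.2.2.2
    have h2 := card_reversible_le_bAT hP hi
    have h3 : Fintype.card (Star n d) ^ 2 ≤ bAT γ P + Fintype.card (Star n d) * (d ^ 2 *
        (4 * (6 * BD d γ + 9 * i + 4 * d + d ^ 2))) := by
      refine h1.trans (Nat.add_le_add ?_ (Nat.mul_le_mul_left _ (Nat.mul_le_mul_left _ ?_)))
      · convert h2
      · have h4 := hP.2.2.1
        rw [hP.2.1]
        omega
    have h5 : ((Fintype.card (Star n d) : ℕ) : ℝ) ^ 2 ≤ bAT γ P +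
        ((Fintype.card (Star n d) : ℕ) : ℝ) * ((d : ℝ) ^ 2 *
          (4 * (6 * BD d γ + 9 * i + 4 * d + (d : ℝ) ^ 2))) := by
      exact_mod_cast h3
    rw [card_star_eq_M3R] at h5
    linarith

end Reg
end
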